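/- arXiv:2509.11907 — 3 statements merged into one kernel-verified Lean document; each statement's English description precedes it below -/
import Mathlib

section
/- For every index i ∈ {1,…,N}, every initial state x₀ ∈ ℝ^{n_x}, every ρ ∈ [0,1] and σ_u > 0, with input u(t) := (1−ρ)·u_d(t) + ρ·σ_u·h(t) (u_d deterministic, h(0),…,h(T−1) i.i.d. standard Gaussian vectors in ℝ^{n_u} independent of the noise sequence g), the following identity holds: Σ_{t=0}^{T−1} E[‖ΔA_i x(t) + ΔB_i u(t)‖_M²] = (1−ρ)²·U_dᵀ W_i U_d + 2(1−ρ)·U_dᵀ m_i(x₀) + c_i(x₀) + ρ²σ_u²·tr(W_i) + tr(S_wᵀ Q_i S_w), where U_d ∈ ℝ^{n_u·T} stacks u_d(0),…,u_d(T−1), Φ(x₀) ∈ ℝ^{n_x·T} stacks (x₀, A_*x₀, …, A_*^{T−1}x₀), m_i(x₀) := S_uᵀ Q_i Φ(x₀) + N_i Φ(x₀), and c_i(x₀) := Σ_{t=0}^{T−1} ‖ΔA_i A_*^t x₀‖_M². -/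
open Matrix MeasureTheory ProbabilityTheory
open scoped Kronecker

noncomputable section

def stdGaussianVec (n : ℕ) : Measure (Fin n → ℝ) :=
  Measure.pi fun _ => gaussianReal 0 1

instance (n : ℕ) : IsProbabilityMeasure (stdGaussianVec n) := by
  unfold stdGaussianVec; infer_instance

def stdGaussianSeq (T n : ℕ) : Measure (Fin T → Fin n → ℝ) :=
  Measure.pi fun _ => stdGaussianVec n

instance (T n : ℕ) : IsProbabilityMeasure (stdGaussianSeq T n) := by
  unfold stdGaussianSeq; infer_instance

def wnormSq {n : ℕ} (M : Matrix (Fin n) (Fin n) ℝ) (v : Fin n → ℝ) : ℝ :=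
  v ⬝ᵥ M.mulVec v

def SuMat (T nx nu : ℕ) (Astar : Matrix (Fin nx) (Fin nx) ℝ)
    (Bstar : Matrix (Fin nx) (Fin nu) ℝ) :
    Matrix (Fin T × Fin nx) (Fin T × Fin nu) ℝ :=
  Matrix.of fun p q =>
    if (q.1 : ℕ) < (p.1 : ℕ) then (Astar ^ ((p.1 : ℕ) - 1 - (q.1 : ℕ)) * Bstar) p.2 q.2 else 0

def SwMat (T nx : ℕ) (Astar sqrtSigw : Matrix (Fin nx) (Fin nx) ℝ) :
    Matrix (Fin T × Fin nx) (Fin T × Fin nx) ℝ :=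
  Matrix.of fun p q =>
    if (q.1 : ℕ) < (p.1 : ℕ) then (Astar ^ ((p.1 : ℕ) - 1 - (q.1 : ℕ)) * sqrtSigw) p.2 q.2 else 0

def Qblk (T nx : ℕ) (M ΔA : Matrix (Fin nx) (Fin nx) ℝ) :
    Matrix (Fin T × Fin nx) (Fin T × Fin nx) ℝ :=
  (1 : Matrix (Fin T) (Fin T) ℝ) ⊗ₖ (ΔAᵀ * M * ΔA)

def Rblk (T nx nu : ℕ) (M : Matrix (Fin nx) (Fin nx) ℝ) (ΔB : Matrix (Fin nx) (Fin nu) ℝ) :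
    Matrix (Fin T × Fin nu) (Fin T × Fin nu) ℝ :=
  (1 : Matrix (Fin T) (Fin T) ℝ) ⊗ₖ (ΔBᵀ * M * ΔB)

def Nblk (T nx nu : ℕ) (M ΔA : Matrix (Fin nx) (Fin nx) ℝ) (ΔB : Matrix (Fin nx) (Fin nu) ℝ) :
    Matrix (Fin T × Fin nu) (Fin T × Fin nx) ℝ :=
  (1 : Matrix (Fin T) (Fin T) ℝ) ⊗ₖ (ΔBᵀ * M * ΔA)

def Wmat (T nx nu : ℕ) (Astar M ΔA : Matrix (Fin nx) (Fin nx) ℝ)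
    (Bstar ΔB : Matrix (Fin nx) (Fin nu) ℝ) :
    Matrix (Fin T × Fin nu) (Fin T × Fin nu) ℝ :=
  Rblk T nx nu M ΔB + (SuMat T nx nu Astar Bstar)ᵀ * Qblk T nx M ΔA * SuMat T nx nu Astar Bstar
    + Nblk T nx nu M ΔA ΔB * SuMat T nx nu Astar Bstar
    + (Nblk T nx nu M ΔA ΔB * SuMat T nx nu Astar Bstar)ᵀ

def lambdaMax {n : ℕ} (M : Matrix (Fin n) (Fin n) ℝ) : ℝ :=
  sSup {r : ℝ | ∃ v : Fin n → ℝ, v ≠ 0 ∧ M.mulVec v = r • v}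

end

/-- Closed form of the solution of a linear recurrence driven by a finite sequence. -/
lemma linear_recurrence_solution {T n : ℕ} (A : Matrix (Fin n) (Fin n) ℝ)
    (f : Fin T → Fin n → ℝ) (x : ℕ → Fin n → ℝ)
    (hx : ∀ t : Fin T, x ((t : ℕ) + 1) = A *ᵥ x t + f t) (t : ℕ) (ht : t ≤ T) :
    x t = (A ^ t) *ᵥ x 0 + ∑ s : Fin T, if (s : ℕ) < t then (A ^ (t - 1 - s)) *ᵥ f s else 0 := by
  induction t with
  | zero => simp
  | succ t ih =>
    have hstep := hx ⟨t, ht⟩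
    simp only at hstep
    rw [hstep, ih (by omega), mulVec_add, mulVec_mulVec, ← pow_succ', mulVec_sum, add_assoc]
    congr 1
    have hf : f ⟨t, ht⟩ = ∑ s : Fin T, if s = ⟨t, ht⟩ then f s else 0 := by simp
    rw [hf, ← Finset.sum_add_distrib]
    refine Finset.sum_congr rfl fun s _ => ?_
    rcases lt_trichotomy (s : ℕ) t with h | h | h
    · have h1 : s ≠ ⟨t, ht⟩ := fun e => by simp [e] at h
      have h2 : t + 1 - 1 - (s : ℕ) = (t - 1 - s) + 1 := by omega
      rw [if_pos h, if_neg h1, if_pos (by omega), h2, mulVec_mulVec, ← pow_succ', add_zero]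
    · have h1 : s = ⟨t, ht⟩ := Fin.ext h
      simp [h1]
    · have h1 : s ≠ ⟨t, ht⟩ := fun e => by simp [e] at h
      simp [h1, show ¬ (s : ℕ) < t by omega, show ¬ (s : ℕ) < t + 1 by omega]

/-- Square-integrable, centred random variables with identity second-moment matrix. -/
structure IsWhite {Ω ι : Type*} [MeasurableSpace Ω] [DecidableEq ι] (μ : Measure Ω)
    (Z : ι → Ω → ℝ) : Prop where
  memLp : ∀ a, MemLp (Z a) 2 μ
  integral_eq_zero : ∀ a, ∫ ω, Z a ω ∂μ = 0
  integral_mul : ∀ a b, ∫ ω, Z a ω * Z b ω ∂μ = (1 : Matrix ι ι ℝ) a b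

lemma IsWhite.comp_measurePreserving {Ω Ω' ι : Type*} [MeasurableSpace Ω] [MeasurableSpace Ω']
    [DecidableEq ι] {μ : Measure Ω} {ν : Measure Ω'} {Z : ι → Ω → ℝ} (hZ : IsWhite μ Z)
    {f : Ω' → Ω} (hf : MeasurePreserving f ν μ) : IsWhite ν fun a ω => Z a (f ω) where
  memLp a := (hZ.memLp a).comp_measurePreserving hf
  integral_eq_zero a := by
    rw [← hZ.integral_eq_zero a, ← hf.map_eq, integral_map hf.aemeasurable]
    rw [hf.map_eq]; exact (hZ.memLp a).1
  integral_mul a b := by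
    rw [← hZ.integral_mul a b, ← hf.map_eq, integral_map hf.aemeasurable]
    rw [hf.map_eq]; exact (hZ.memLp a).1.mul (hZ.memLp b).1

lemma IsWhite.sumElim_prod {Ω Ω' ι κ : Type*} [MeasurableSpace Ω] [MeasurableSpace Ω']
    [DecidableEq ι] [DecidableEq κ] {μ : Measure Ω} {ν : Measure Ω'}
    [IsProbabilityMeasure μ] [IsProbabilityMeasure ν] {Y : ι → Ω → ℝ} {Z : κ → Ω' → ℝ}
    (hY : IsWhite μ Y) (hZ : IsWhite ν Z) :
    IsWhite (μ.prod ν) (fun (c : ι ⊕ κ) (ω : Ω × Ω') => Sum.elim (Y · ω.1) (Z · ω.2) c) := by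
  have hY' := hY.comp_measurePreserving (measurePreserving_fst (μ := μ) (ν := ν))
  have hZ' := hZ.comp_measurePreserving (measurePreserving_snd (μ := μ) (ν := ν))
  refine ⟨?_, ?_, ?_⟩
  · rintro (a | a)
    exacts [hY'.memLp a, hZ'.memLp a]
  · rintro (a | a)
    exacts [hY'.integral_eq_zero a, hZ'.integral_eq_zero a]
  · rintro (a | a) (b | b)
    · simpa [Matrix.one_apply] using hY'.integral_mul a b
    · simp [integral_prod_mul (Y a) (Z b), hY.integral_eq_zero]
    · simp only [Sum.elim_inl, Sum.elim_inr]
      simp_rw [mul_comm (Z a _)]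
      simp [integral_prod_mul (Y b) (Z a), hZ.integral_eq_zero]
    · simpa [Matrix.one_apply] using hZ'.integral_mul a b

lemma IsWhite.pi {Ω ι κ : Type*} [MeasurableSpace Ω] [DecidableEq ι] [DecidableEq κ] [Fintype κ]
    {μ : Measure Ω} [IsProbabilityMeasure μ] {Z : ι → Ω → ℝ} (hZ : IsWhite μ Z) :
    IsWhite (Measure.pi fun _ : κ => μ) (fun (p : κ × ι) (ω : κ → Ω) => Z p.2 (ω p.1)) := by
  have h k := hZ.comp_measurePreserving (measurePreserving_eval (fun _ : κ => μ) k)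
  refine ⟨fun p => (h p.1).memLp p.2, fun p => (h p.1).integral_eq_zero p.2, ?_⟩
  rintro ⟨k, a⟩ ⟨l, b⟩
  by_cases hkl : k = l
  · subst hkl
    simpa [Matrix.one_apply] using (h k).integral_mul a b
  · have hind := (iIndepFun_pi (μ := fun _ : κ => μ) (X := fun _ ω => ω)
      (fun _ => aemeasurable_id)).indepFun hkl
    have hk : AEStronglyMeasurable (Z a) (Measure.map (fun ω : κ → Ω => ω k) (.pi fun _ => μ)) := by
      rw [(measurePreserving_eval (fun _ : κ => μ) k).map_eq]; exact (hZ.memLp a).1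
    have hl : AEStronglyMeasurable (Z b) (Measure.map (fun ω : κ → Ω => ω l) (.pi fun _ => μ)) := by
      rw [(measurePreserving_eval (fun _ : κ => μ) l).map_eq]; exact (hZ.memLp b).1
    have := hind.integral_fun_comp_mul_comp (f := Z a) (g := Z b)
      (measurable_pi_apply k).aemeasurable (measurable_pi_apply l).aemeasurable hk hl
    simp only at this ⊢
    rw [this, (h k).integral_eq_zero a, zero_mul, Matrix.one_apply_ne (by simp [hkl])]

lemma isWhite_gaussianReal : IsWhite (gaussianReal 0 1) (fun (_ : Unit) x => x) where
  memLp _ := memLp_id_gaussianReal 2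
  integral_eq_zero _ := by simp
  integral_mul _ _ := by
    have h := variance_fun_id_gaussianReal (μ := 0) (v := 1)
    rw [variance_of_integral_eq_zero aemeasurable_id' (by simp)] at h
    simpa [sq] using h

lemma IsWhite.reindex {Ω ι κ : Type*} [MeasurableSpace Ω] [DecidableEq ι] [DecidableEq κ]
    {μ : Measure Ω} {Z : ι → Ω → ℝ} (hZ : IsWhite μ Z) {e : κ → ι} (he : e.Injective) :
    IsWhite μ fun k => Z (e k) where
  memLp _ := hZ.memLp _
  integral_eq_zero _ := hZ.integral_eq_zero _
  integral_mul _ _ := by simp [hZ.integral_mul, Matrix.one_apply, he.eq_iff]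

lemma isWhite_stdGaussianSeq (T n : ℕ) :
    IsWhite (stdGaussianSeq T n) (fun (p : Fin T × Fin n) ω => ω p.1 p.2) := by
  have h : IsWhite (stdGaussianVec n) (fun (j : Fin n) ω => ω j) :=
    (isWhite_gaussianReal.pi (κ := Fin n)).reindex (e := fun j => (j, ())) fun _ _ => by simp
  exact h.pi

lemma memLp_add_mulVec {Ω ι κ : Type*} [MeasurableSpace Ω] [Fintype ι] [DecidableEq ι]
    {μ : Measure Ω} [IsProbabilityMeasure μ] {Z : ι → Ω → ℝ}
    (hZ : IsWhite μ Z) (a : κ → ℝ) (C : Matrix κ ι ℝ) (k : κ) :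
    MemLp (fun ω => (a + C *ᵥ fun i => Z i ω) k) 2 μ := by
  simp only [Pi.add_apply, mulVec, dotProduct]
  refine (memLp_const (a k)).add (memLp_finsetSum (f := fun i ω => C k i * Z i ω) _ fun i _ => ?_)
  exact (hZ.memLp i).const_mul _

lemma integrable_dotProduct_mulVec {Ω κ : Type*} [MeasurableSpace Ω] [Fintype κ]
    {μ : Measure Ω} {Y : Ω → κ → ℝ} (hY : ∀ k, MemLp (fun ω => Y ω k) 2 μ) (M : Matrix κ κ ℝ) :
    Integrable (fun ω => Y ω ⬝ᵥ M *ᵥ Y ω) μ := by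
  simp only [mulVec, dotProduct, Finset.mul_sum]
  refine integrable_finsetSum _ fun k _ => integrable_finsetSum _ fun l _ => ?_
  refine (((hY k).integrable_mul (hY l)).const_mul (M k l)).congr (.of_forall fun ω => ?_)
  simp only [Pi.mul_apply]; ring

lemma IsWhite.integral_quadratic {Ω ι κ : Type*} [MeasurableSpace Ω] [Fintype ι] [Fintype κ]
    [DecidableEq ι] {μ : Measure Ω} [IsProbabilityMeasure μ] {Z : ι → Ω → ℝ}
    (hZ : IsWhite μ Z) (a : κ → ℝ) (C : Matrix κ ι ℝ) (M : Matrix κ κ ℝ) :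
    ∫ ω, (a + C *ᵥ fun i => Z i ω) ⬝ᵥ M *ᵥ (a + C *ᵥ fun i => Z i ω) ∂μ
      = a ⬝ᵥ M *ᵥ a + (Cᵀ * M * C).trace := by
  have hint i : Integrable (Z i) μ := (hZ.memLp i).integrable (by norm_num)
  have hint2 i j : Integrable (fun ω => Z i ω * Z j ω) μ := (hZ.memLp i).integrable_mul (hZ.memLp j)
  set b : ι → ℝ := a ᵥ* (M * C) + (M *ᵥ a) ᵥ* C
  set K : Matrix ι ι ℝ := Cᵀ * M * C
  have hexp ω : (a + C *ᵥ fun i => Z i ω) ⬝ᵥ M *ᵥ (a + C *ᵥ fun i => Z i ω)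
      = a ⬝ᵥ M *ᵥ a + ∑ i, b i * Z i ω + ∑ i, ∑ j, K i j * (Z i ω * Z j ω) := by
    have h1 : ∑ i, b i * Z i ω = b ⬝ᵥ fun i => Z i ω := rfl
    have h2 : ∑ i, ∑ j, K i j * (Z i ω * Z j ω) = (fun i => Z i ω) ⬝ᵥ K *ᵥ fun i => Z i ω := by
      simp only [dotProduct, mulVec, Finset.mul_sum]
      exact Finset.sum_congr rfl fun i _ => Finset.sum_congr rfl fun j _ => by ring
    rw [h1, h2]
    simp only [b, K, mulVec_add, dotProduct_add, add_dotProduct, ← mulVec_mulVec,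
      ← dotProduct_mulVec, dotProduct_transpose_mulVec]
    rw [dotProduct_comm (C *ᵥ _) (M *ᵥ a), dotProduct_comm (M *ᵥ C *ᵥ _) (C *ᵥ _)]
    ring
  simp_rw [hexp]
  rw [integral_add, integral_add, integral_const, integral_finsetSum, integral_finsetSum]
  · simp_rw [integral_const_mul, hZ.integral_eq_zero]
    have h i : ∫ ω, ∑ j, K i j * (Z i ω * Z j ω) ∂μ = K i i := by
      rw [integral_finsetSum _ fun j _ => (hint2 i j).const_mul _]
      simp [integral_const_mul, hZ.integral_mul, Matrix.one_apply]
    simp [h, Matrix.trace]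
  · exact fun i _ => integrable_finsetSum _ fun j _ => (hint2 i j).const_mul _
  · exact fun i _ => (hint i).const_mul _
  · exact integrable_const _
  · exact integrable_finsetSum _ fun i _ => (hint i).const_mul _
  · exact (integrable_const _).add (integrable_finsetSum _ fun i _ => (hint i).const_mul _)
  · exact integrable_finsetSum _ fun i _ => integrable_finsetSum _ fun j _ => (hint2 i j).const_mul _

lemma one_kronecker_mulVec {τ m n : Type*} [Fintype τ] [DecidableEq τ] [Fintype n]
    (P : Matrix m n ℝ) (v : τ × n → ℝ) (p : τ × m) :
    (((1 : Matrix τ τ ℝ) ⊗ₖ P) *ᵥ v) p = (P *ᵥ fun j => v (p.1, j)) p.2 := by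
  simp [mulVec, dotProduct, Fintype.sum_prod_type, Matrix.one_apply, ite_mul,
    Finset.sum_ite_irrel]

lemma sum_wnormSq_eq {T n : ℕ} (M : Matrix (Fin n) (Fin n) ℝ) (v : Fin T × Fin n → ℝ) :
    ∑ t, wnormSq M (fun j => v (t, j)) = v ⬝ᵥ ((1 : Matrix (Fin T) (Fin T) ℝ) ⊗ₖ M) *ᵥ v := by
  simp only [wnormSq, dotProduct, Fintype.sum_prod_type, one_kronecker_mulVec]

lemma SuMat_mulVec_apply {T nx nu : ℕ} (A : Matrix (Fin nx) (Fin nx) ℝ)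
    (B : Matrix (Fin nx) (Fin nu) ℝ) (u : Fin T → Fin nu → ℝ) (t : Fin T) (j : Fin nx) :
    (SuMat T nx nu A B *ᵥ fun p => u p.1 p.2) (t, j)
      = ∑ s : Fin T, if (s : ℕ) < t then ((A ^ ((t : ℕ) - 1 - s)) *ᵥ B *ᵥ u s) j else 0 := by
  simp only [SuMat, mulVec, dotProduct, Fintype.sum_prod_type, Matrix.of_apply]
  refine Finset.sum_congr rfl fun s _ => ?_
  split_ifs
  · exact (congrFun (mulVec_mulVec (u s) (A ^ ((t : ℕ) - 1 - s)) B) j).symm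
  · simp

lemma trajectory_eq {T nx nu : ℕ} (A S : Matrix (Fin nx) (Fin nx) ℝ)
    (B : Matrix (Fin nx) (Fin nu) ℝ) (u : Fin T → Fin nu → ℝ) (g : Fin T → Fin nx → ℝ)
    (x : ℕ → Fin nx → ℝ)
    (hx : ∀ t : Fin T, x ((t : ℕ) + 1) = A *ᵥ x t + B *ᵥ u t + S *ᵥ g t) :
    (fun p : Fin T × Fin nx => x p.1 p.2) =
      (fun p => ((A ^ (p.1 : ℕ)) *ᵥ x 0) p.2) + (SuMat T nx nu A B *ᵥ fun p => u p.1 p.2)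
        + (SwMat T nx A S *ᵥ fun p => g p.1 p.2) := by
  ext ⟨t, j⟩
  have h := congrFun (linear_recurrence_solution A (fun t => B *ᵥ u t + S *ᵥ g t) x
    (fun t => by rw [hx t, add_assoc]) t t.2.le) j
  rw [Pi.add_apply, Pi.add_apply, SuMat_mulVec_apply,
    show SwMat T nx A S = SuMat T nx nx A S from rfl, SuMat_mulVec_apply, h, Pi.add_apply,
    Finset.sum_apply, add_assoc, ← Finset.sum_add_distrib]
  congr 1
  refine Finset.sum_congr rfl fun s _ => ?_
  split_ifs
  · rw [mulVec_add, Pi.add_apply]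
  · simp

/-- Block-diagonal congruence: `I ⊗ (Pᵀ M R)` factors through `I ⊗ M`. -/
lemma one_kronecker_transpose_mul_mul {τ k l m n : Type*} [Fintype τ] [DecidableEq τ] [Fintype k]
    [Fintype l] (P : Matrix k m ℝ) (M : Matrix k l ℝ) (R : Matrix l n ℝ) :
    ((1 : Matrix τ τ ℝ) ⊗ₖ P)ᵀ * ((1 : Matrix τ τ ℝ) ⊗ₖ M) * ((1 : Matrix τ τ ℝ) ⊗ₖ R)
      = (1 : Matrix τ τ ℝ) ⊗ₖ (Pᵀ * M * R) := by
  simp only [← kroneckerMap_transpose, ← mul_kronecker_mul, transpose_one, Matrix.mul_one]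

lemma transpose_mul_mul_eq_Wmat (T nx nu : ℕ) {Astar M : Matrix (Fin nx) (Fin nx) ℝ}
    (hM : Mᵀ = M) (ΔA : Matrix (Fin nx) (Fin nx) ℝ) (Bstar ΔB : Matrix (Fin nx) (Fin nu) ℝ) :
    ((1 : Matrix (Fin T) (Fin T) ℝ) ⊗ₖ ΔA * SuMat T nx nu Astar Bstar + 1 ⊗ₖ ΔB)ᵀ
        * ((1 : Matrix (Fin T) (Fin T) ℝ) ⊗ₖ M)
        * ((1 : Matrix (Fin T) (Fin T) ℝ) ⊗ₖ ΔA * SuMat T nx nu Astar Bstar + 1 ⊗ₖ ΔB)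
      = Wmat T nx nu Astar M ΔA Bstar ΔB := by
  have hMk : ((1 : Matrix (Fin T) (Fin T) ℝ) ⊗ₖ M)ᵀ = (1 : Matrix (Fin T) (Fin T) ℝ) ⊗ₖ M := by
    rw [← kroneckerMap_transpose, hM, transpose_one]
  simp only [Wmat, Qblk, Rblk, Nblk, ← one_kronecker_transpose_mul_mul]
  simp only [transpose_add, transpose_mul, transpose_transpose, hMk,
    Matrix.add_mul, Matrix.mul_add, Matrix.mul_assoc]
  abel

/-- Lemma of Appendix G of the paper: exact decomposition of the expected sum of weighted
one-step prediction-error differences, for the mixed input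
`u(t) = (1-ρ)·u_d(t) + ρ·σ_u·h(t)`. -/
theorem expected_error_decomposition
    (nx nu N T : ℕ) (hnx : 1 ≤ nx) (hnu : 1 ≤ nu) (hN : 1 ≤ N) (hT : 1 ≤ T)
    (Astar : Matrix (Fin nx) (Fin nx) ℝ) (Bstar : Matrix (Fin nx) (Fin nu) ℝ)
    (Sigw sqrtSigw : Matrix (Fin nx) (Fin nx) ℝ)
    (hSigw : Sigw.PosDef) (hsqrtW : sqrtSigw.PosSemidef) (hsqrtW2 : sqrtSigw * sqrtSigw = Sigw)
    (A : Fin N → Matrix (Fin nx) (Fin nx) ℝ) (B : Fin N → Matrix (Fin nx) (Fin nu) ℝ)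
    (M : Matrix (Fin nx) (Fin nx) ℝ) (hM : M.PosDef)
    (i : Fin N) (x₀ : Fin nx → ℝ) (ρ σu : ℝ) (hρ : ρ ∈ Set.Icc (0 : ℝ) 1) (hσu : 0 < σu)
    (ud : Fin T → Fin nu → ℝ)
    (x : ℕ → ((Fin T → Fin nu → ℝ) × (Fin T → Fin nx → ℝ)) → (Fin nx → ℝ))
    (hx0 : ∀ ω, x 0 ω = x₀)
    (hxrec : ∀ (t : Fin T) ω,
      x ((t : ℕ) + 1) ω =
        Astar.mulVec (x (t : ℕ) ω)
          + Bstar.mulVec ((1 - ρ) • ud t + (ρ * σu) • ω.1 t)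
          + sqrtSigw.mulVec (ω.2 t)) :
    (∑ t : Fin T,
        ∫ ω, wnormSq M ((Astar - A i).mulVec (x (t : ℕ) ω)
            + (Bstar - B i).mulVec ((1 - ρ) • ud t + (ρ * σu) • ω.1 t))
          ∂((stdGaussianSeq T nu).prod (stdGaussianSeq T nx)))
      = (1 - ρ) ^ 2 *
          ((fun p : Fin T × Fin nu => ud p.1 p.2) ⬝ᵥ
            (Wmat T nx nu Astar M (Astar - A i) Bstar (Bstar - B i)).mulVec
              (fun p : Fin T × Fin nu => ud p.1 p.2))
        + 2 * (1 - ρ) *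
          ((fun p : Fin T × Fin nu => ud p.1 p.2) ⬝ᵥ
            ((SuMat T nx nu Astar Bstar)ᵀ.mulVec
                ((Qblk T nx M (Astar - A i)).mulVec
                  (fun p : Fin T × Fin nx => (Astar ^ (p.1 : ℕ)).mulVec x₀ p.2))
              + (Nblk T nx nu M (Astar - A i) (Bstar - B i)).mulVec
                  (fun p : Fin T × Fin nx => (Astar ^ (p.1 : ℕ)).mulVec x₀ p.2)))
        + (∑ t : Fin T, wnormSq M ((Astar - A i).mulVec ((Astar ^ (t : ℕ)).mulVec x₀)))
        + ρ ^ 2 * σu ^ 2 *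
            (Wmat T nx nu Astar M (Astar - A i) Bstar (Bstar - B i)).trace
        + ((SwMat T nx Astar sqrtSigw)ᵀ * Qblk T nx M (Astar - A i) *
            SwMat T nx Astar sqrtSigw).trace := by
  set ΔA := Astar - A i
  set ΔB := Bstar - B i
  have hMT : Mᵀ = M := by simpa using hM.isHermitian.eq
  let 𝒜 : Matrix (Fin T × Fin nx) (Fin T × Fin nx) ℝ := (1 : Matrix (Fin T) (Fin T) ℝ) ⊗ₖ ΔA
  let ℬ : Matrix (Fin T × Fin nx) (Fin T × Fin nu) ℝ := (1 : Matrix (Fin T) (Fin T) ℝ) ⊗ₖ ΔB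
  let ℳ : Matrix (Fin T × Fin nx) (Fin T × Fin nx) ℝ := (1 : Matrix (Fin T) (Fin T) ℝ) ⊗ₖ M
  let Φ : Fin T × Fin nx → ℝ := fun p => (Astar ^ (p.1 : ℕ)).mulVec x₀ p.2
  let U : Fin T × Fin nu → ℝ := fun p => ud p.1 p.2
  let L := 𝒜 * SuMat T nx nu Astar Bstar + ℬ
  let D := 𝒜 * SwMat T nx Astar sqrtSigw
  let a := 𝒜 *ᵥ Φ + (1 - ρ) • L *ᵥ U
  let C := fromCols ((ρ * σu) • L) D
  let Z := fun (c : (Fin T × Fin nu) ⊕ (Fin T × Fin nx))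
    (ω : (Fin T → Fin nu → ℝ) × (Fin T → Fin nx → ℝ)) =>
      Sum.elim (fun p : Fin T × Fin nu => ω.1 p.1 p.2) (fun p : Fin T × Fin nx => ω.2 p.1 p.2) c
  have hZ : IsWhite ((stdGaussianSeq T nu).prod (stdGaussianSeq T nx)) Z :=
    (isWhite_stdGaussianSeq T nu).sumElim_prod (isWhite_stdGaussianSeq T nx)
  have herr t ω : ΔA *ᵥ x (t : Fin T) ω + ΔB *ᵥ ((1 - ρ) • ud t + (ρ * σu) • ω.1 t)
      = fun j => (a + C *ᵥ fun c => Z c ω) (t, j) := by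
    have hX := trajectory_eq Astar sqrtSigw Bstar
      (fun t => (1 - ρ) • ud t + (ρ * σu) • ω.1 t) ω.2 (x · ω) (hxrec · ω)
    have hV : (fun p : Fin T × Fin nu => ((1 - ρ) • ud p.1 + (ρ * σu) • ω.1 p.1) p.2)
        = (1 - ρ) • U + (ρ * σu) • fun p : Fin T × Fin nu => ω.1 p.1 p.2 := rfl
    have hE : a + (C *ᵥ fun c => Z c ω) = 𝒜 *ᵥ (fun p : Fin T × Fin nx => x p.1 ω p.2)
        + ℬ *ᵥ fun p : Fin T × Fin nu => ((1 - ρ) • ud p.1 + (ρ * σu) • ω.1 p.1) p.2 := by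
      have hC : (C *ᵥ fun c => Z c ω) = ((ρ * σu) • L) *ᵥ (fun p => ω.1 p.1 p.2)
          + D *ᵥ fun p => ω.2 p.1 p.2 := fromCols_mulVec_sumElim _ _ _ _
      rw [hC, hX, hV, hx0]
      simp only [a, L, D, mulVec_add, add_mulVec, mulVec_smul, smul_mulVec, ← mulVec_mulVec,
        smul_add, Φ]
      abel
    ext j
    rw [hE]
    simp only [𝒜, ℬ, Pi.add_apply, one_kronecker_mulVec]
    rfl
  have hW : Lᵀ * ℳ * L = Wmat T nx nu Astar M ΔA Bstar ΔB :=
    transpose_mul_mul_eq_Wmat T nx nu hMT ΔA Bstar ΔB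
  have hQ : 𝒜ᵀ * ℳ * 𝒜 = Qblk T nx M ΔA :=
    one_kronecker_transpose_mul_mul _ _ _
  have hN : ℬᵀ * ℳ * 𝒜 = Nblk T nx nu M ΔA ΔB :=
    one_kronecker_transpose_mul_mul _ _ _
  have hsymm (v w : Fin T × Fin nx → ℝ) : v ⬝ᵥ ℳ *ᵥ w = w ⬝ᵥ ℳ *ᵥ v := by
    have hℳ : ℳᵀ = ℳ := by
      rw [← kroneckerMap_transpose, hMT, transpose_one]
    rw [← dotProduct_transpose_mulVec, hℳ]
  have htrace : (Cᵀ * ℳ * C).trace = ρ ^ 2 * σu ^ 2 * (Lᵀ * ℳ * L).trace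
      + (Dᵀ * ℳ * D).trace := by
    simp only [C]
    rw [transpose_fromCols, fromRows_mul, fromRows_mul_fromCols]
    simp only [transpose_smul, Matrix.smul_mul, Matrix.mul_smul, trace, Fintype.sum_sum_type, diag_apply,
      fromBlocks_apply₁₁, fromBlocks_apply₂₂, Matrix.smul_apply, smul_eq_mul, ← Finset.mul_sum]
    ring
  have hD : Dᵀ * ℳ * D = (SwMat T nx Astar sqrtSigw)ᵀ * Qblk T nx M ΔA
      * SwMat T nx Astar sqrtSigw := by
    simp only [D, ← hQ, transpose_mul, Matrix.mul_assoc]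
  have hΦ : ∑ t : Fin T, wnormSq M (ΔA *ᵥ (Astar ^ (t : ℕ)) *ᵥ x₀)
      = 𝒜 *ᵥ Φ ⬝ᵥ ℳ *ᵥ 𝒜 *ᵥ Φ := by
    rw [← sum_wnormSq_eq]
    simp only [𝒜, one_kronecker_mulVec, Φ]
  have hcross : U ⬝ᵥ ((SuMat T nx nu Astar Bstar)ᵀ *ᵥ Qblk T nx M ΔA *ᵥ Φ
      + Nblk T nx nu M ΔA ΔB *ᵥ Φ) = L *ᵥ U ⬝ᵥ ℳ *ᵥ 𝒜 *ᵥ Φ := by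
    rw [dotProduct_comm (L *ᵥ U), ← dotProduct_transpose_mulVec L]
    simp only [← hQ, ← hN, L, transpose_add, transpose_mul, Matrix.add_mul, add_mulVec,
      mulVec_mulVec, Matrix.mul_assoc]
  have hquad : U ⬝ᵥ (Lᵀ * ℳ * L) *ᵥ U = L *ᵥ U ⬝ᵥ ℳ *ᵥ L *ᵥ U := by
    rw [dotProduct_comm (L *ᵥ U), ← dotProduct_transpose_mulVec L]
    simp only [mulVec_mulVec, Matrix.mul_assoc]
  simp_rw [herr]
  have hint (t : Fin T) : Integrable
      (fun ω => wnormSq M fun j => (a + C *ᵥ fun c => Z c ω) (t, j))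
      ((stdGaussianSeq T nu).prod (stdGaussianSeq T nx)) :=
    integrable_dotProduct_mulVec (fun j => memLp_add_mulVec hZ a C (t, j)) M
  rw [← integral_finsetSum _ fun t _ => hint t]
  simp_rw [sum_wnormSq_eq]
  rw [hZ.integral_quadratic, htrace, hD, ← hW]
  change _ = (1 - ρ) ^ 2 * (U ⬝ᵥ (Lᵀ * ℳ * L) *ᵥ U) + 2 * (1 - ρ) * (U ⬝ᵥ
    ((SuMat T nx nu Astar Bstar)ᵀ *ᵥ Qblk T nx M ΔA *ᵥ Φ + Nblk T nx nu M ΔA ΔB *ᵥ Φ)) + _ + _ + _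
  rw [hcross, hΦ, hquad]
  simp only [a, mulVec_add, dotProduct_add, add_dotProduct, mulVec_smul, dotProduct_smul,
    smul_dotProduct, smul_eq_mul]
  rw [hsymm (𝒜 *ᵥ Φ) (L *ᵥ U)]
  ring
end

section
/- Persistency of excitation for the optimal oracle excitation (inequality established in the proof of Lemma 3.5): let the initial state be x₀ = 0, let γ > 0, and for a deterministic input sequence U ∈ ℝ^{n_u·τ} (with u(t) the t-th block of U) define F_i(U) := Σ_{t=0}^{τ−1} E[‖ΔA_i x(t) + ΔB_i u(t)‖²_{Σ_w^{-1}}], where the expectation is over the process noise. Suppose U* satisfies (U*)ᵀU* ≤ γ²τ and maximizes the map U ↦ min_{i∈{1,…,N}} F_i(U) over the ball {U ∈ ℝ^{n_u·τ} : UᵀU ≤ γ²τ}. Then for every i ∈ {1,…,N}: F_i(U*) ≥ sup_{V : VᵀV ≤ γ²τ} min_{j∈{1,…,N}} Vᵀ W_j V + min_{j∈{1,…,N}} tr(S_wᵀ Q_j S_w). -/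
open Matrix MeasureTheory ProbabilityTheory
open scoped Kronecker

/-- State trajectory of the LTI system `x(t+1) = A x(t) + B u(t) + Σ_w^{1/2} g(t)`. -/
noncomputable def traj (nx nu : ℕ) (Astar : Matrix (Fin nx) (Fin nx) ℝ)
    (Bstar : Matrix (Fin nx) (Fin nu) ℝ) (sqrtSigw : Matrix (Fin nx) (Fin nx) ℝ)
    (x₀ : Fin nx → ℝ) (u : ℕ → Fin nu → ℝ) (g : ℕ → Fin nx → ℝ) : ℕ → (Fin nx → ℝ)
  | 0 => x₀
  | t + 1 =>
      Astar.mulVec (traj nx nu Astar Bstar sqrtSigw x₀ u g t)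
        + Bstar.mulVec (u t) + sqrtSigw.mulVec (g t)

/-- First and second moments of a quadratic form in a vector of uncorrelated, centred,
unit-variance random variables. -/
theorem integral_wnormSq_add_mulVec {Ω ι : Type*} [Fintype ι] [DecidableEq ι] [MeasurableSpace Ω]
    {μ : Measure Ω} [IsProbabilityMeasure μ] {n : ℕ} (X : Ω → ι → ℝ)
    (hX : ∀ p, Integrable (fun ω => X ω p) μ) (hX0 : ∀ p, ∫ ω, X ω p ∂μ = 0)
    (hXX : ∀ p q, Integrable (fun ω => X ω p * X ω q) μ)
    (hcov : ∀ p q, ∫ ω, X ω p * X ω q ∂μ = if p = q then 1 else 0)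
    (M : Matrix (Fin n) (Fin n) ℝ) (D : Matrix (Fin n) ι ℝ) (v : Fin n → ℝ) :
    ∫ ω, wnormSq M (v + D *ᵥ X ω) ∂μ = wnormSq M v + (Dᵀ * M * D).trace := by
  have key : ∀ x : ι → ℝ, wnormSq M (v + D *ᵥ x) =
      wnormSq M v + ∑ p, (v ᵥ* (M * D) + (M *ᵥ v) ᵥ* D) p * x p
        + ∑ p, ∑ q, (Dᵀ * M * D) p q * (x p * x q) := by
    intro x
    have h1 : ∑ p, (v ᵥ* (M * D) + (M *ᵥ v) ᵥ* D) p * x p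
        = v ⬝ᵥ M *ᵥ (D *ᵥ x) + (D *ᵥ x) ⬝ᵥ M *ᵥ v := by
      change (v ᵥ* (M * D) + (M *ᵥ v) ᵥ* D) ⬝ᵥ x = _
      rw [add_dotProduct, ← dotProduct_mulVec, ← dotProduct_mulVec, ← mulVec_mulVec,
        dotProduct_comm (M *ᵥ v)]
    have h2 : ∑ p, ∑ q, (Dᵀ * M * D) p q * (x p * x q) = (D *ᵥ x) ⬝ᵥ M *ᵥ (D *ᵥ x) := by
      have : (D *ᵥ x) ⬝ᵥ M *ᵥ (D *ᵥ x) = x ⬝ᵥ (Dᵀ * M * D) *ᵥ x := by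
        rw [← mulVec_mulVec, ← mulVec_mulVec, dotProduct_mulVec x, vecMul_transpose]
      rw [this]
      simp only [dotProduct, mulVec, Finset.mul_sum]
      exact Finset.sum_congr rfl fun p _ => Finset.sum_congr rfl fun q _ => by ring
    rw [h1, h2]
    simp only [wnormSq, mulVec_add, add_dotProduct, dotProduct_add]
    ring
  simp only [key]
  have i1 : Integrable (fun ω => ∑ p, (v ᵥ* (M * D) + (M *ᵥ v) ᵥ* D) p * X ω p) μ :=
    integrable_finsetSum _ fun p _ => (hX p).const_mul _
  have i2 : ∀ p, Integrable (fun ω => ∑ q, (Dᵀ * M * D) p q * (X ω p * X ω q)) μ :=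
    fun p => integrable_finsetSum _ fun q _ => (hXX p q).const_mul _
  have i3 : Integrable (fun ω => wnormSq M v
      + ∑ p, (v ᵥ* (M * D) + (M *ᵥ v) ᵥ* D) p * X ω p) μ := (integrable_const _).add i1
  rw [integral_add i3 (integrable_finsetSum _ fun p _ => i2 p),
    integral_add (integrable_const _) i1, integral_finsetSum _ fun p _ => (hX p).const_mul _,
    integral_finsetSum _ fun p _ => i2 p]
  simp only [integral_finsetSum _ fun q _ => (hXX _ q).const_mul _, integral_const_mul, hX0, hcov]
  simp [trace]

theorem memLp_two_stdGaussianSeq_apply {T n : ℕ} (s : Fin T) (a : Fin n) :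
    MemLp (fun ω : Fin T → Fin n → ℝ => ω s a) 2 (stdGaussianSeq T n) := by
  have h1 : MeasurePreserving (fun ω : Fin T → Fin n → ℝ => ω s a) (stdGaussianSeq T n)
      (gaussianReal 0 1) :=
    (measurePreserving_eval (fun _ : Fin n => gaussianReal 0 1) a).comp
      (measurePreserving_eval (fun _ : Fin T => stdGaussianVec n) s)
  exact (memLp_id_gaussianReal 2).comp_measurePreserving h1

theorem integral_stdGaussianSeq_comp_apply {T n : ℕ} (s : Fin T) (a : Fin n) {f : ℝ → ℝ}
    (hf : Measurable f) :
    ∫ ω : Fin T → Fin n → ℝ, f (ω s a) ∂(stdGaussianSeq T n) = ∫ x, f x ∂(gaussianReal 0 1) := by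
  have h1 : MeasurePreserving (fun ω : Fin T → Fin n → ℝ => ω s a) (stdGaussianSeq T n)
      (gaussianReal 0 1) :=
    (measurePreserving_eval (fun _ : Fin n => gaussianReal 0 1) a).comp
      (measurePreserving_eval (fun _ : Fin T => stdGaussianVec n) s)
  rw [← h1.map_eq, integral_map h1.measurable.aemeasurable hf.aestronglyMeasurable]

theorem integral_stdGaussianSeq_apply {T n : ℕ} (s : Fin T) (a : Fin n) :
    ∫ ω : Fin T → Fin n → ℝ, ω s a ∂(stdGaussianSeq T n) = 0 := by
  rw [integral_stdGaussianSeq_comp_apply s a measurable_id (f := fun x => x)]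
  exact integral_id_gaussianReal

theorem integral_stdGaussianSeq_mul_apply {T n : ℕ} (p q : Fin T × Fin n) :
    ∫ ω : Fin T → Fin n → ℝ, ω p.1 p.2 * ω q.1 q.2 ∂(stdGaussianSeq T n)
      = if p = q then 1 else 0 := by
  obtain ⟨s, a⟩ := p
  obtain ⟨s', a'⟩ := q
  by_cases hs : s = s'
  · subst hs
    by_cases ha : a = a'
    · subst ha
      have hv := variance_of_integral_eq_zero (X := id) (μ := gaussianReal 0 1)
        measurable_id.aemeasurable integral_id_gaussianReal
      rw [variance_id_gaussianReal] at hv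
      rw [integral_stdGaussianSeq_comp_apply s a (f := fun x => x * x) (by fun_prop)]
      simpa [sq] using hv.symm
    · have hind : IndepFun (fun v : Fin n → ℝ => v a) (fun v => v a') (stdGaussianVec n) :=
        (iIndepFun_pi (μ := fun _ : Fin n => gaussianReal 0 1) (X := fun _ => id)
          fun _ => aemeasurable_id).indepFun ha
      have hm : MeasurePreserving (fun ω : Fin T → Fin n → ℝ => ω s) (stdGaussianSeq T n)
        (stdGaussianVec n) := measurePreserving_eval _ s
      have hz : ∫ v : Fin n → ℝ, v a ∂(stdGaussianVec n) = 0 := by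
        rw [← integral_stdGaussianSeq_apply s a, ← hm.map_eq,
          integral_map hm.measurable.aemeasurable (measurable_pi_apply a).aestronglyMeasurable]
      have hmap := integral_map (μ := stdGaussianSeq T n) hm.measurable.aemeasurable
        (f := fun v : Fin n → ℝ => v a * v a') (by fun_prop)
      rw [hm.map_eq] at hmap
      rw [← hmap, hind.integral_fun_mul_eq_mul_integral
        (measurable_pi_apply a).aestronglyMeasurable
        (measurable_pi_apply a').aestronglyMeasurable, hz]
      simp [ha]
  · have hind : IndepFun (fun ω : Fin T → Fin n → ℝ => ω s a) (fun ω => ω s' a')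
        (stdGaussianSeq T n) := by
      have h := (iIndepFun_pi (μ := fun _ : Fin T => stdGaussianVec n) (X := fun _ => id)
        fun _ => aemeasurable_id).indepFun hs
      exact h.comp (measurable_pi_apply a) (measurable_pi_apply a')
    rw [hind.integral_fun_mul_eq_mul_integral (memLp_two_stdGaussianSeq_apply s a).1
      (memLp_two_stdGaussianSeq_apply s' a').1, integral_stdGaussianSeq_apply]
    simp [hs]

theorem traj_zero_eq_sum {nx nu : ℕ} (A : Matrix (Fin nx) (Fin nx) ℝ)
    (B : Matrix (Fin nx) (Fin nu) ℝ) (S : Matrix (Fin nx) (Fin nx) ℝ)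
    (u : ℕ → Fin nu → ℝ) (g : ℕ → Fin nx → ℝ) (t : ℕ) :
    traj nx nu A B S 0 u g t =
      ∑ s ∈ Finset.range t, ((A ^ (t - 1 - s) * B) *ᵥ u s + (A ^ (t - 1 - s) * S) *ᵥ g s) := by
  induction t with
  | zero => simp [traj]
  | succ t ih =>
    rw [traj, ih, Finset.sum_range_succ, mulVec_sum, add_assoc]
    congr 1
    · refine Finset.sum_congr rfl fun s hs => ?_
      have : t + 1 - 1 - s = t - 1 - s + 1 := by
        have := Finset.mem_range.1 hs
        omega
      rw [this, pow_succ', mulVec_add, mulVec_mulVec, mulVec_mulVec, Matrix.mul_assoc,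
        Matrix.mul_assoc]
    · simp

/-- Multiplying a stacked vector by a strictly lower block-triangular matrix. -/
theorem mulVec_lowerBlock_apply {T m k : ℕ} (G : ℕ → ℕ → Matrix (Fin m) (Fin k) ℝ)
    (U : Fin T × Fin k → ℝ) (t : Fin T) (a : Fin m) :
    ((Matrix.of fun (p : Fin T × Fin m) (q : Fin T × Fin k) =>
        if (q.1 : ℕ) < (p.1 : ℕ) then G p.1 q.1 p.2 q.2 else 0) *ᵥ U) (t, a)
      = ∑ s ∈ Finset.range t,
          (G t s *ᵥ fun b => if h : s < T then U (⟨s, h⟩, b) else 0) a := by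
  have hext : ∀ s : Fin T, (if (s : ℕ) < t then (G t s *ᵥ fun b => U (s, b)) a else 0)
      = (fun s : ℕ => if s < (t : ℕ) then
          (G t s *ᵥ fun b => if h : s < T then U (⟨s, h⟩, b) else 0) a else 0) s := by
    intro s
    simp
  have hsub : Finset.range t = (Finset.range T).filter (· < (t : ℕ)) := by
    ext s
    have := t.2
    simp only [Finset.mem_range, Finset.mem_filter]
    omega
  rw [hsub, Finset.sum_filter, ← Fin.sum_univ_eq_sum_range
    (fun s : ℕ => if s < (t : ℕ) then
      (G t s *ᵥ fun b => if h : s < T then U (⟨s, h⟩, b) else 0) a else 0) T]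
  simp only [← hext]
  simp only [mulVec, dotProduct, Fintype.sum_prod_type, of_apply]
  refine Finset.sum_congr rfl fun s _ => ?_
  split_ifs <;> simp

theorem traj_zero_eq_mulVec {nx nu T : ℕ} (A : Matrix (Fin nx) (Fin nx) ℝ)
    (B : Matrix (Fin nx) (Fin nu) ℝ) (S : Matrix (Fin nx) (Fin nx) ℝ)
    (U : Fin T × Fin nu → ℝ) (ω : Fin T → Fin nx → ℝ) (t : Fin T) :
    traj nx nu A B S 0 (fun s b => if h : s < T then U (⟨s, h⟩, b) else 0)
        (fun s => if h : s < T then ω ⟨s, h⟩ else 0) (t : ℕ)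
      = fun a => (SuMat T nx nu A B *ᵥ U) (t, a)
          + (SwMat T nx A S *ᵥ fun p => ω p.1 p.2) (t, a) := by
  funext a
  rw [traj_zero_eq_sum, SuMat, SwMat,
    mulVec_lowerBlock_apply (fun t s => A ^ (t - 1 - s) * B),
    mulVec_lowerBlock_apply (fun t s => A ^ (t - 1 - s) * S), ← Finset.sum_add_distrib,
    Finset.sum_apply]
  refine Finset.sum_congr rfl fun s _ => ?_
  have : (if h : s < T then ω ⟨s, h⟩ else 0)
      = fun b => if h : s < T then ω ⟨s, h⟩ b else 0 := by
    split_ifs <;> rfl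
  rw [this]
  rfl

theorem dotProduct_one_kronecker_mulVec {T m k : ℕ} (G : Matrix (Fin m) (Fin k) ℝ)
    (y : Fin T × Fin m → ℝ) (z : Fin T × Fin k → ℝ) :
    y ⬝ᵥ ((1 : Matrix (Fin T) (Fin T) ℝ) ⊗ₖ G) *ᵥ z
      = ∑ t, (fun a => y (t, a)) ⬝ᵥ G *ᵥ fun b => z (t, b) := by
  simp only [dotProduct, mulVec, Fintype.sum_prod_type, kroneckerMap_apply, one_apply]
  simp

theorem sum_wnormSq_eq_dotProduct_Wmat {T nx nu : ℕ} (A M ΔA : Matrix (Fin nx) (Fin nx) ℝ)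
    (B ΔB : Matrix (Fin nx) (Fin nu) ℝ) (hM : Mᵀ = M) (U : Fin T × Fin nu → ℝ) :
    ∑ t : Fin T, wnormSq M (ΔA *ᵥ (fun a => (SuMat T nx nu A B *ᵥ U) (t, a))
        + ΔB *ᵥ fun b => U (t, b))
      = U ⬝ᵥ (Wmat T nx nu A M ΔA B ΔB) *ᵥ U := by
  have hT : U ⬝ᵥ (Nblk T nx nu M ΔA ΔB * SuMat T nx nu A B)ᵀ *ᵥ U
      = U ⬝ᵥ Nblk T nx nu M ΔA ΔB *ᵥ SuMat T nx nu A B *ᵥ U := by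
    rw [mulVec_transpose, dotProduct_comm, ← dotProduct_mulVec, mulVec_mulVec]
  rw [Wmat, add_mulVec, add_mulVec, add_mulVec, dotProduct_add, dotProduct_add, dotProduct_add, hT,
    ← mulVec_mulVec, ← mulVec_mulVec, ← mulVec_mulVec, dotProduct_mulVec U (SuMat T nx nu A B)ᵀ,
    vecMul_transpose]
  generalize SuMat T nx nu A B *ᵥ U = x
  simp only [Rblk, Qblk, Nblk, dotProduct_one_kronecker_mulVec, ← Finset.sum_add_distrib]
  refine Finset.sum_congr rfl fun t _ => ?_
  generalize (fun a => x (t, a)) = y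
  generalize (fun b => U (t, b)) = z
  have e : ∀ {k l : ℕ} (P : Matrix (Fin nx) (Fin k) ℝ) (R : Matrix (Fin nx) (Fin l) ℝ)
      (c : Fin k → ℝ) (d : Fin l → ℝ), c ⬝ᵥ (Pᵀ * M * R) *ᵥ d = (P *ᵥ c) ⬝ᵥ M *ᵥ R *ᵥ d := by
    intro k l P R c d
    rw [← mulVec_mulVec, ← mulVec_mulVec, dotProduct_mulVec c, vecMul_transpose]
  have hsymm : (ΔA *ᵥ y) ⬝ᵥ M *ᵥ ΔB *ᵥ z = (ΔB *ᵥ z) ⬝ᵥ M *ᵥ ΔA *ᵥ y := by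
    rw [dotProduct_mulVec, dotProduct_comm, ← mulVec_transpose, hM]
  simp only [e, wnormSq, mulVec_add, add_dotProduct, dotProduct_add, hsymm]
  ring

theorem trace_transpose_mul_one_kronecker_mul {T m k : ℕ} {ι : Type*} [Fintype ι]
    (M : Matrix (Fin m) (Fin m) ℝ) (D : Matrix (Fin m) (Fin k) ℝ)
    (S : Matrix (Fin T × Fin k) ι ℝ) :
    (Sᵀ * ((1 : Matrix (Fin T) (Fin T) ℝ) ⊗ₖ (Dᵀ * M * D)) * S).trace
      = ∑ t, ((D * S.submatrix (Prod.mk t) id)ᵀ * M * (D * S.submatrix (Prod.mk t) id)).trace := by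
  have h : ∀ {κ : Type} [Fintype κ] (P : Matrix κ ι ℝ) (G : Matrix κ κ ℝ),
      (Pᵀ * G * P).trace = ∑ p, (fun a => P a p) ⬝ᵥ G *ᵥ fun a => P a p := by
    intro κ _ P G
    rw [Matrix.mul_assoc]
    rfl
  rw [h]
  simp only [dotProduct_one_kronecker_mulVec]
  rw [Finset.sum_comm]
  refine Finset.sum_congr rfl fun t _ => ?_
  have hassoc : (D * S.submatrix (Prod.mk t) id)ᵀ * M * (D * S.submatrix (Prod.mk t) id)
      = (S.submatrix (Prod.mk t) id)ᵀ * (Dᵀ * M * D) * S.submatrix (Prod.mk t) id := by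
    simp only [transpose_mul, Matrix.mul_assoc]
  rw [hassoc, h]
  rfl

theorem sum_integral_wnormSq_traj {T nx nu : ℕ} (A M ΔA : Matrix (Fin nx) (Fin nx) ℝ)
    (B ΔB : Matrix (Fin nx) (Fin nu) ℝ) (S : Matrix (Fin nx) (Fin nx) ℝ) (hM : Mᵀ = M)
    (U : Fin T × Fin nu → ℝ) :
    ∑ t : Fin T, ∫ ω, wnormSq M
        (ΔA *ᵥ (traj nx nu A B S 0 (fun s b => if h : s < T then U (⟨s, h⟩, b) else 0)
            (fun s => if h : s < T then ω ⟨s, h⟩ else 0) (t : ℕ))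
          + ΔB *ᵥ fun b => U (t, b)) ∂(stdGaussianSeq T nx)
      = U ⬝ᵥ (Wmat T nx nu A M ΔA B ΔB) *ᵥ U
        + ((SwMat T nx A S)ᵀ * Qblk T nx M ΔA * SwMat T nx A S).trace := by
  rw [← sum_wnormSq_eq_dotProduct_Wmat A M ΔA B ΔB hM, Qblk, trace_transpose_mul_one_kronecker_mul,
    ← Finset.sum_add_distrib]
  refine Finset.sum_congr rfl fun t _ => ?_
  rw [← integral_wnormSq_add_mulVec (μ := stdGaussianSeq T nx)
    (fun ω (p : Fin T × Fin nx) => ω p.1 p.2)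
    (fun p => (memLp_two_stdGaussianSeq_apply p.1 p.2).integrable one_le_two)
    (fun p => integral_stdGaussianSeq_apply p.1 p.2)
    (fun p q => (memLp_two_stdGaussianSeq_apply p.1 p.2).integrable_mul
      (memLp_two_stdGaussianSeq_apply q.1 q.2))
    integral_stdGaussianSeq_mul_apply]
  refine integral_congr_ae (.of_forall fun ω => ?_)
  simp only [traj_zero_eq_mulVec]
  congr 1
  rw [← mulVec_mulVec, add_right_comm, ← mulVec_add]
  rfl

/-- Persistency of excitation for the optimal oracle excitation (inequality established in the
proof of Lemma 3.5 of the paper). -/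
theorem PE_optimal_oracle_excitation
    (nx nu N τ : ℕ) (hnx : 1 ≤ nx) (hnu : 1 ≤ nu) (hN : 1 ≤ N) (hτ : 1 ≤ τ)
    (Astar : Matrix (Fin nx) (Fin nx) ℝ) (Bstar : Matrix (Fin nx) (Fin nu) ℝ)
    (Sigw sqrtSigw : Matrix (Fin nx) (Fin nx) ℝ)
    (hSigw : Sigw.PosDef) (hsqrtW : sqrtSigw.PosSemidef) (hsqrtW2 : sqrtSigw * sqrtSigw = Sigw)
    (A : Fin N → Matrix (Fin nx) (Fin nx) ℝ) (B : Fin N → Matrix (Fin nx) (Fin nu) ℝ)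
    (γ : ℝ) (hγ : 0 < γ)
    (F : Fin N → (Fin τ × Fin nu → ℝ) → ℝ)
    (hF : ∀ (j : Fin N) (U : Fin τ × Fin nu → ℝ),
      F j U = ∑ t : Fin τ,
        ∫ ω, wnormSq Sigw⁻¹
            ((Astar - A j).mulVec
                (traj nx nu Astar Bstar sqrtSigw 0
                  (fun s b => if h : s < τ then U (⟨s, h⟩, b) else 0)
                  (fun s => if h : s < τ then ω ⟨s, h⟩ else 0) (t : ℕ))
              + (Bstar - B j).mulVec (fun b => U (t, b)))
          ∂(stdGaussianSeq τ nx))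
    (Ustar : Fin τ × Fin nu → ℝ)
    (hUstar : Ustar ⬝ᵥ Ustar ≤ γ ^ 2 * τ)
    (hUopt : ∀ V : Fin τ × Fin nu → ℝ, V ⬝ᵥ V ≤ γ ^ 2 * τ →
      (⨅ j : Fin N, F j V) ≤ ⨅ j : Fin N, F j Ustar) :
    ∀ i : Fin N,
      F i Ustar ≥
        sSup {r : ℝ | ∃ V : Fin τ × Fin nu → ℝ, V ⬝ᵥ V ≤ γ ^ 2 * τ ∧
            r = ⨅ j : Fin N,
              V ⬝ᵥ (Wmat τ nx nu Astar Sigw⁻¹ (Astar - A j) Bstar (Bstar - B j)).mulVec V}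
        + ⨅ j : Fin N,
            ((SwMat τ nx Astar sqrtSigw)ᵀ * Qblk τ nx Sigw⁻¹ (Astar - A j) *
              SwMat τ nx Astar sqrtSigw).trace := by
  intro i
  have : Nonempty (Fin N) := ⟨i⟩
  have hM : (Sigw⁻¹)ᵀ = Sigw⁻¹ := by
    simpa [IsHermitian, conjTranspose_eq_transpose_of_trivial] using hSigw.isHermitian.inv
  have hbdd : ∀ f : Fin N → ℝ, BddBelow (Set.range f) := fun f => (Set.finite_range f).bddBelow
  rw [ge_iff_le, ← le_sub_iff_add_le]
  refine csSup_le ⟨_, 0, by simpa using by positivity, rfl⟩ ?_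
  rintro r ⟨V, hV, rfl⟩
  rw [le_sub_iff_add_le]
  refine le_trans (le_ciInf fun j => ?_) ((hUopt V hV).trans (ciInf_le (hbdd _) i))
  rw [hF, sum_integral_wnormSq_traj _ _ _ _ _ _ hM]
  exact add_le_add (ciInf_le (hbdd _) j) (ciInf_le (hbdd _) j)
end

section
/- Per-block exponential prediction-error inequality (core of Proposition E.1): in the LTI trajectory setup with horizon τ, let the input be u(t) := u_d(t) + Σ_u^{1/2} h(t), where u_d is a deterministic sequence, Σ_u is a real symmetric positive definite n_u×n_u matrix, and h(0),…,h(τ−1) are i.i.d. standard Gaussian vectors in ℝ^{n_u} independent of the noise sequence g. For a candidate pair θ = (A, B) define ε_θ := Σ_{t=0}^{τ−1} ‖x(t+1) − A x(t) − B u(t)‖²_{Σ_w^{-1}}, and let θ_* := (A_*, B_*), θ_i := (A_i, B_i). Define Σ_{Δi}(t) := ΔA_i (Σ_{s=0}^{t−1} A_*^{t−1−s}(B_* Σ_u B_*ᵀ + Σ_w)(A_*^{t−1−s})ᵀ) ΔA_iᵀ + ΔB_i Σ_u ΔB_iᵀ, and suppose λ_max(Σ_{Δi}(τ)^{1/2}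 Σ_w^{-1} Σ_{Δi}(τ)^{1/2}) > 0, where Σ_{Δi}(τ)^{1/2} is the positive semidefinite square root. If η > 0 satisfies η·τ ≤ 1/4 and η·τ·λ_max(Σ_{Δi}(τ)^{1/2} Σ_w^{-1} Σ_{Δi}(τ)^{1/2}) ≤ 1/512, then E[exp(−η(ε_{θ_i} − ε_{θ_*}))] ≤ exp(−(η/4)·Σ_{t=0}^{τ−1} E[‖ΔA_i x(t) + ΔB_i u(t)‖²_{Σ_w^{-1}}]). -/
open Matrix MeasureTheory ProbabilityTheory

lemma one_div_sqrt_le_exp {u : ℝ} (hu : 0 ≤ u) (hu' : u ≤ 1 / 3) :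
    1 / √(1 + u) ≤ Real.exp (-(3 / 8) * u) := by
  have h1 : 0 < 1 + u := by linarith
  have hlog : u * (3 / 4) ≤ Real.log (1 + u) := by
    have := Real.one_sub_inv_le_log_of_pos h1
    refine le_trans ?_ this
    rw [← sub_nonneg]
    have : 1 - (1 + u)⁻¹ - u * (3 / 4) = u * (1 / 4 - 3 / 4 * u) / (1 + u) := by
      field_simp; ring
    rw [this]
    have : 0 ≤ 1 / 4 - 3 / 4 * u := by linarith
    positivity
  rw [Real.sqrt_eq_rpow, Real.rpow_def_of_pos h1, one_div, ← Real.exp_neg]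
  apply Real.exp_le_exp.mpr
  linarith

lemma integral_exp_neg_mul_sq_gaussianReal_le (m : ℝ) (v : NNReal) {lam : ℝ} (hlam : 0 ≤ lam)
    (hv : lam * v ≤ 1 / 6) :
    ∫ y, Real.exp (-lam * y ^ 2) ∂(gaussianReal m v)
      ≤ Real.exp (-(3 / 4) * lam * (m ^ 2 + v)) := by
  rcases eq_or_ne v 0 with rfl | hv0
  · simp only [gaussianReal_zero_var, integral_dirac, NNReal.coe_zero, add_zero]
    apply Real.exp_le_exp.mpr
    nlinarith [mul_nonneg hlam (sq_nonneg m)]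
  have hvpos : (0 : ℝ) < v := by positivity
  set w : ℝ := (v : ℝ) with hw
  have hD : 0 < 1 + 2 * lam * w := by positivity
  set b : ℝ := (1 + 2 * lam * w) / (2 * w) with hb
  have hbpos : 0 < b := by positivity
  have key : ∀ y : ℝ, gaussianPDFReal m v y • Real.exp (-lam * y ^ 2)
      = ((√(2 * Real.pi * w))⁻¹ * Real.exp (-(lam * m ^ 2 / (1 + 2 * lam * w))))
        * Real.exp (-b * (y - m / (1 + 2 * lam * w)) ^ 2) := by
    intro y
    rw [gaussianPDFReal, smul_eq_mul, mul_assoc (_)⁻¹, mul_assoc (_)⁻¹, ← Real.exp_add, ← Real.exp_add]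
    congr 2
    rw [← hw, hb]
    field_simp
    ring
  rw [integral_gaussianReal_eq_integral_smul hv0]
  simp_rw [key]
  rw [integral_const_mul, integral_sub_right_eq_self (fun y => Real.exp (-b * y ^ 2)),
    integral_gaussian]
  have hsq : √(Real.pi / b) = √(2 * Real.pi * w) * (1 / √(1 + 2 * lam * w)) := by
    rw [hb, one_div, ← Real.sqrt_inv, ← Real.sqrt_mul (by positivity)]
    congr 1
    field_simp
  have hpos : √(2 * Real.pi * w) ≠ 0 := by positivity
  rw [hsq]
  have : (√(2 * Real.pi * w))⁻¹ * Real.exp (-(lam * m ^ 2 / (1 + 2 * lam * w)))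
      * (√(2 * Real.pi * w) * (1 / √(1 + 2 * lam * w)))
      = Real.exp (-(lam * m ^ 2 / (1 + 2 * lam * w))) * (1 / √(1 + 2 * lam * w)) := by
    field_simp
  rw [this]
  have hu := one_div_sqrt_le_exp (u := 2 * lam * w) (by positivity) (by linarith)
  have hm : Real.exp (-(lam * m ^ 2 / (1 + 2 * lam * w))) ≤ Real.exp (-(3 / 4) * lam * m ^ 2) := by
    apply Real.exp_le_exp.mpr
    have : 3 / 4 * (lam * m ^ 2) ≤ lam * m ^ 2 / (1 + 2 * lam * w) := by
      rw [le_div_iff₀ hD]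
      have : 0 ≤ lam * m ^ 2 := by positivity
      nlinarith
    linarith
  calc _ ≤ Real.exp (-(3 / 4) * lam * m ^ 2) * Real.exp (-(3 / 8) * (2 * lam * w)) := by gcongr
    _ = _ := by rw [← Real.exp_add]; congr 1; ring

lemma exists_orthogonal_diagonalization {n : ℕ} {H : Matrix (Fin n) (Fin n) ℝ}
    (hH : H.IsHermitian) :
    ∃ (U : Matrix (Fin n) (Fin n) ℝ) (d : Fin n → ℝ),
      Uᵀ * U = 1 ∧ U * Uᵀ = 1 ∧ Uᵀ * H * U = diagonal d ∧
        ∀ j, H *ᵥ (Uᵀ j) = d j • Uᵀ j := by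
  refine ⟨hH.eigenvectorUnitary, hH.eigenvalues, ?_, ?_, ?_, ?_⟩
  · have := Unitary.coe_star_mul_self hH.eigenvectorUnitary
    rwa [star_eq_conjTranspose, conjTranspose_eq_transpose_of_trivial] at this
  · have := Unitary.coe_mul_star_self hH.eigenvectorUnitary
    rwa [Unitary.coe_star, star_eq_conjTranspose, conjTranspose_eq_transpose_of_trivial] at this
  · have := hH.conjStarAlgAut_star_eigenvectorUnitary
    rw [Unitary.conjStarAlgAut_star_apply] at this
    rwa [star_eq_conjTranspose, conjTranspose_eq_transpose_of_trivial] at this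
  · intro j
    rw [hH.eigenvectorUnitary_transpose_apply]
    exact hH.mulVec_eigenvectorBasis j

lemma integral_exp_neg_mul_dotProduct_self_le {Ω : Type*} {mΩ : MeasurableSpace Ω}
    {P : Measure Ω} {n : ℕ} {X : Ω → Fin n → ℝ} (hX : HasGaussianLaw X P) {c lam : ℝ}
    (hlam : 0 ≤ lam) (hc : lam * c ≤ 1 / 6)
    (hvar : ∀ a : Fin n → ℝ, Var[fun ω => a ⬝ᵥ X ω; P] ≤ c * (a ⬝ᵥ a)) :
    ∫ ω, Real.exp (-lam * (X ω ⬝ᵥ X ω)) ∂P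
      ≤ Real.exp (-(3 / 4) * lam * ∫ ω, X ω ⬝ᵥ X ω ∂P) := by
  have := hX.isProbabilityMeasure
  have hmem : ∀ i, MemLp (fun ω => X ω i) 2 P := fun i => (hX.eval i).memLp_two
  let S : Matrix (Fin n) (Fin n) ℝ := of fun i j => cov[fun ω => X ω i, fun ω => X ω j; P]
  have hS : S.IsHermitian := by
    ext i j
    exact covariance_comm _ _
  obtain ⟨U, d, hU1, hU2, hUS, -⟩ := exists_orthogonal_diagonalization hS
  let Y : Fin n → Ω → ℝ := fun j ω => Uᵀ j ⬝ᵥ X ω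
  have hYgauss : HasGaussianLaw (fun ω => (Y · ω)) P :=
    hX.map_fun (LinearMap.toContinuousLinearMap (Matrix.mulVecLin Uᵀ))
  have hcov : ∀ i j, cov[Y i, Y j; P] = (Uᵀ * S * U) i j := by
    intro i j
    simp only [Y, dotProduct]
    rw [covariance_fun_sum_fun_sum (fun k => (hmem k).const_mul _)
      (fun k => (hmem k).const_mul _)]
    simp_rw [covariance_const_mul_left, covariance_const_mul_right]
    simp only [Matrix.mul_apply, Finset.sum_mul, transpose_apply, S, of_apply]
    rw [Finset.sum_comm]
    exact Finset.sum_congr rfl fun k _ => Finset.sum_congr rfl fun l _ => by ring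
  have hind : iIndepFun Y P := hYgauss.iIndepFun_of_covariance_eq_zero fun i j hij => by
    rw [hcov, hUS, diagonal_apply_ne _ hij]
  have hnorm : ∀ ω, X ω ⬝ᵥ X ω = ∑ j, Y j ω ^ 2 := by
    intro ω
    have : ∑ j, Y j ω ^ 2 = (Uᵀ *ᵥ X ω) ⬝ᵥ (Uᵀ *ᵥ X ω) :=
      Finset.sum_congr rfl fun j _ => sq _
    rw [this, dotProduct_mulVec, vecMul_mulVec, transpose_transpose, hU2, vecMul_one]
  have hYlaw : ∀ j, P.map (Y j) = gaussianReal P[Y j] Var[Y j; P].toNNReal :=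
    fun j => (hYgauss.eval j).map_eq_gaussianReal
  have hYmeas : ∀ j, AEMeasurable (Y j) P := fun j => (hYgauss.eval j).aemeasurable
  have hYsq : ∀ j, ∫ ω, Y j ω ^ 2 ∂P = P[Y j] ^ 2 + Var[Y j; P] := by
    intro j
    rw [variance_eq_sub (hYgauss.eval j).memLp_two]
    simp
  have hone : ∀ j, Uᵀ j ⬝ᵥ Uᵀ j = 1 := by
    intro j
    have := congrFun (congrFun hU1 j) j
    simpa [Matrix.mul_apply, dotProduct] using this
  have hfac : ∀ j, ∫ ω, Real.exp (-lam * Y j ω ^ 2) ∂P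
      ≤ Real.exp (-(3 / 4) * lam * ∫ ω, Y j ω ^ 2 ∂P) := by
    intro j
    have h1 : ∫ ω, Real.exp (-lam * Y j ω ^ 2) ∂P
        = ∫ y, Real.exp (-lam * y ^ 2) ∂(P.map (Y j)) := by
      rw [integral_map (hYmeas j) (by fun_prop)]
    rw [h1, hYlaw, hYsq]
    have hn := variance_nonneg (Y j) P
    have := integral_exp_neg_mul_sq_gaussianReal_le P[Y j] Var[Y j; P].toNNReal hlam (by
      rw [Real.coe_toNNReal _ hn]
      have := hvar (Uᵀ j)
      rw [hone, mul_one] at this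
      exact (mul_le_mul_of_nonneg_left this hlam).trans hc)
    rwa [Real.coe_toNNReal _ hn] at this
  simp_rw [hnorm, Finset.mul_sum, Real.exp_sum]
  have hind' : iIndepFun (fun j ω => Real.exp (-lam * Y j ω ^ 2)) P :=
    hind.comp (fun _ y => Real.exp (-lam * y ^ 2)) (fun _ => by fun_prop)
  rw [hind'.integral_fun_prod_eq_prod_integral
      (fun j => by have := hYmeas j; fun_prop),
    integral_finsetSum _ (fun j _ => (hYgauss.eval j).memLp_two.integrable_sq),
    Finset.mul_sum, Real.exp_sum]
  exact Finset.prod_le_prod (fun j _ => integral_nonneg fun ω => (Real.exp_pos _).le)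
    (fun j _ => hfac j)

lemma isGaussian_pi {ι : Type*} [Fintype ι] {E : ι → Type*} [∀ i, NormedAddCommGroup (E i)]
    [∀ i, NormedSpace ℝ (E i)] [∀ i, MeasurableSpace (E i)] [∀ i, BorelSpace (E i)]
    [∀ i, CompleteSpace (E i)] [∀ i, SecondCountableTopology (E i)]
    (μ : ∀ i, Measure (E i)) [∀ i, IsGaussian (μ i)] : IsGaussian (Measure.pi μ) := by
  have hlaw : ∀ i, (Measure.pi μ).map (fun ω => ω i) = μ i := fun i =>
    (measurePreserving_eval μ i).map_eq
  have h : HasGaussianLaw (fun ω i => ω i) (Measure.pi μ) :=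
    iIndepFun.hasGaussianLaw (X := fun i (ω : ∀ i, E i) => ω i)
      (fun i => ⟨by rw [hlaw i]; infer_instance⟩)
      (iIndepFun_pi (X := fun i (y : E i) => y) fun i => aemeasurable_id)
  simpa using h.isGaussian_map

instance (n : ℕ) : IsGaussian (stdGaussianVec n) := isGaussian_pi _

instance (T n : ℕ) : IsGaussian (stdGaussianSeq T n) := isGaussian_pi _

lemma variance_dotProduct_stdGaussianVec {n : ℕ} (a : Fin n → ℝ) :
    Var[fun y => a ⬝ᵥ y; stdGaussianVec n] = a ⬝ᵥ a := by
  have h := variance_sum_pi (μ := fun _ : Fin n => gaussianReal 0 1)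
    (X := fun i y => a i * y) (fun i => (memLp_id_gaussianReal 2).const_mul (a i))
  have he : (∑ i, fun y : Fin n → ℝ => a i * y i) = fun y => a ⬝ᵥ y := by
    ext y; simp [dotProduct]
  rw [he] at h
  rw [stdGaussianVec, h]
  refine Finset.sum_congr rfl fun i _ => ?_
  rw [variance_const_mul, variance_fun_id_gaussianReal]
  simp [sq]

lemma memLp_dotProduct_stdGaussianVec {n : ℕ} (a : Fin n → ℝ) :
    MemLp (fun y => a ⬝ᵥ y) 2 (stdGaussianVec n) :=
  (IsGaussian.hasGaussianLaw_id.map_fun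
    (LinearMap.toContinuousLinearMap (dotProductBilin ℝ ℝ a))).memLp_two

lemma variance_sum_dotProduct_stdGaussianSeq {T n : ℕ} (α : Fin T → Fin n → ℝ) :
    Var[fun h => ∑ s, α s ⬝ᵥ h s; stdGaussianSeq T n] = ∑ s, α s ⬝ᵥ α s := by
  have h := variance_sum_pi (μ := fun _ : Fin T => stdGaussianVec n)
    (X := fun s y => α s ⬝ᵥ y) (fun s => memLp_dotProduct_stdGaussianVec (α s))
  have he : (∑ s, fun h : Fin T → Fin n → ℝ => α s ⬝ᵥ h s) = fun h => ∑ s, α s ⬝ᵥ h s := by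
    ext y; simp
  rw [he] at h
  rw [stdGaussianSeq, h]
  exact Finset.sum_congr rfl fun s _ => variance_dotProduct_stdGaussianVec _

/-- The linear functional `h ↦ ∑ s, α s ⬝ᵥ h s`. -/
noncomputable def seqDotCLM {T n : ℕ} (α : Fin T → Fin n → ℝ) : (Fin T → Fin n → ℝ) →L[ℝ] ℝ :=
  LinearMap.toContinuousLinearMap (∑ s, dotProductBilin ℝ ℝ (α s) ∘ₗ LinearMap.proj s)

lemma seqDotCLM_apply {T n : ℕ} (α h : Fin T → Fin n → ℝ) :
    seqDotCLM α h = ∑ s, α s ⬝ᵥ h s := by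
  simp [seqDotCLM]

lemma variance_stdGaussianSeq_prod {T nu nx : ℕ} (α : Fin T → Fin nu → ℝ) (β : Fin T → Fin nx → ℝ)
    (m : ℝ) :
    Var[fun ω => m + (∑ s, α s ⬝ᵥ ω.1 s + ∑ s, β s ⬝ᵥ ω.2 s);
        (stdGaussianSeq T nu).prod (stdGaussianSeq T nx)]
      = ∑ s, α s ⬝ᵥ α s + ∑ s, β s ⬝ᵥ β s := by
  rw [variance_const_add (by fun_prop),
    variance_add_prod (μ := stdGaussianSeq T nu) (ν := stdGaussianSeq T nx)
      (X := fun h : Fin T → Fin nu → ℝ => ∑ s, α s ⬝ᵥ h s)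
      (Y := fun h : Fin T → Fin nx → ℝ => ∑ s, β s ⬝ᵥ h s),
    variance_sum_dotProduct_stdGaussianSeq, variance_sum_dotProduct_stdGaussianSeq]
  · simpa only [seqDotCLM_apply, id] using
      (IsGaussian.hasGaussianLaw_id.map_fun (P := stdGaussianSeq T nu) (seqDotCLM α)).memLp_two
  · simpa only [seqDotCLM_apply, id] using
      (IsGaussian.hasGaussianLaw_id.map_fun (P := stdGaussianSeq T nx) (seqDotCLM β)).memLp_two

lemma hasGaussianLaw_stdGaussianSeq_prod {T nu nx n : ℕ}
    {X : (Fin T → Fin nu → ℝ) × (Fin T → Fin nx → ℝ) → Fin n → ℝ} (m : Fin n → ℝ)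
    (α : Fin n → Fin T → Fin nu → ℝ) (β : Fin n → Fin T → Fin nx → ℝ)
    (hX : ∀ i ω, X ω i = m i + (∑ s, α i s ⬝ᵥ ω.1 s + ∑ s, β i s ⬝ᵥ ω.2 s)) :
    HasGaussianLaw X ((stdGaussianSeq T nu).prod (stdGaussianSeq T nx)) := by
  let L : (Fin T → Fin nu → ℝ) × (Fin T → Fin nx → ℝ) →L[ℝ] (Fin n → ℝ) :=
    ContinuousLinearMap.pi fun i => (seqDotCLM (α i)).coprod (seqDotCLM (β i))
  have hXL : X = fun ω => m + L ω := by
    ext ω i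
    simp [hX, L, seqDotCLM_apply]
  have : IsGaussian
      ((((stdGaussianSeq T nu).prod (stdGaussianSeq T nx)).map L).map (fun x => m + x)) :=
    inferInstance
  rw [Measure.map_map (by fun_prop) (by fun_prop)] at this
  exact ⟨by rw [hXL]; exact this⟩

lemma lintegral_pi_eq_lintegral_update {ι E : Type*} [Fintype ι] [DecidableEq ι]
    [MeasurableSpace E] (μ : ι → Measure E) [∀ i, IsProbabilityMeasure (μ i)] (k : ι)
    {f : (ι → E) → ENNReal} (hf : Measurable f) :
    ∫⁻ g, f g ∂(Measure.pi μ) = ∫⁻ g, ∫⁻ e, f (Function.update g k e) ∂(μ k) ∂(Measure.pi μ) := by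
  have hm : Measurable fun g => ∫⁻ e, f (Function.update g k e) ∂(μ k) := by
    rw [← lmarginal_singleton]
    exact hf.lmarginal μ
  refine lintegral_eq_of_lmarginal_eq {k} hf hm ?_
  rw [lmarginal_singleton, lmarginal_singleton]
  ext g
  simp

/-- A product of adapted factors, each with conditional expectation at most one given the
past, has expectation at most one. -/
lemma lintegral_prod_adapted_le_one {E : Type*} [MeasurableSpace E] {T : ℕ} (μ : Measure E)
    [IsProbabilityMeasure μ] (F : Fin T → (Fin T → E) → ENNReal) (hF : ∀ t, Measurable (F t))
    (hadapted : ∀ s t, s < t → ∀ g e, F s (Function.update g t e) = F s g)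
    (hone : ∀ t g, ∫⁻ e, F t (Function.update g t e) ∂μ ≤ 1) :
    ∫⁻ g, ∏ t, F t g ∂(Measure.pi fun _ => μ) ≤ 1 := by
  suffices h : ∀ k : ℕ, ∫⁻ g, ∏ t with t.val < k, F t g ∂(Measure.pi fun _ => μ) ≤ 1 by
    have := h T
    rwa [Finset.filter_true_of_mem (fun t _ => t.isLt)] at this
  intro k
  induction k with
  | zero => simp
  | succ k ih =>
    by_cases hk : k < T
    · let t₀ : Fin T := ⟨k, hk⟩
      have hins : Finset.univ.filter (fun t : Fin T => t.val < k + 1)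
          = insert t₀ (Finset.univ.filter fun t : Fin T => t.val < k) := by
        ext t
        simp [t₀, Fin.ext_iff, le_iff_eq_or_lt]
      rw [hins]
      have hnot : t₀ ∉ Finset.univ.filter fun t : Fin T => t.val < k := by simp [t₀]
      simp_rw [Finset.prod_insert hnot]
      rw [lintegral_pi_eq_lintegral_update _ t₀
        (by have := hF; fun_prop)]
      refine le_trans (lintegral_mono fun g => ?_) ih
      have hpast : ∀ e, ∏ t with t.val < k, F t (Function.update g t₀ e)
          = ∏ t with t.val < k, F t g := fun e =>
        Finset.prod_congr rfl fun t ht => hadapted t t₀ (by simpa [t₀, Fin.lt_def] using ht) g e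
      simp_rw [hpast]
      rw [lintegral_mul_const _ (show Measurable fun e => F t₀ (Function.update g t₀ e) from
        (hF t₀).comp (measurable_update g))]
      exact mul_le_of_le_one_left zero_le (hone t₀ g)
    · have : (Finset.univ.filter fun t : Fin T => t.val < k + 1)
          = Finset.univ.filter fun t : Fin T => t.val < k := by
        ext t
        simp only [Finset.mem_filter, Finset.mem_univ, true_and]
        omega
      rw [this]
      exact ih

lemma dotProduct_self_nonneg {n : ℕ} (v : Fin n → ℝ) : 0 ≤ v ⬝ᵥ v :=
  Finset.sum_nonneg fun i _ => mul_self_nonneg (v i)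

lemma integral_dotProduct_stdGaussianVec {n : ℕ} (y : Fin n → ℝ) :
    ∫ e, y ⬝ᵥ e ∂(stdGaussianVec n) = 0 := by
  simp only [dotProduct]
  rw [integral_finsetSum _ fun i _ =>
    (show Integrable (fun e : Fin n → ℝ => e i) (stdGaussianVec n) from
      (IsGaussian.hasGaussianLaw_id.eval i).integrable).const_mul (y i)]
  refine Finset.sum_eq_zero fun i _ => ?_
  rw [integral_const_mul, stdGaussianVec,
    integral_comp_eval (μ := fun _ : Fin n => gaussianReal 0 1) (f := fun x : ℝ => x)
      (by fun_prop), integral_id_gaussianReal, mul_zero]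

lemma lintegral_exp_dotProduct_stdGaussianVec {n : ℕ} (y : Fin n → ℝ) (c : ℝ) :
    ∫⁻ e, ENNReal.ofReal (Real.exp (-c * (y ⬝ᵥ e) - c ^ 2 / 2 * (y ⬝ᵥ y)))
      ∂(stdGaussianVec n) = 1 := by
  have hgauss : HasGaussianLaw (fun e => y ⬝ᵥ e) (stdGaussianVec n) :=
    IsGaussian.hasGaussianLaw_id.map_fun
      (LinearMap.toContinuousLinearMap (dotProductBilin ℝ ℝ y))
  have hlaw := hgauss.map_eq_gaussianReal
  rw [integral_dotProduct_stdGaussianVec, variance_dotProduct_stdGaussianVec] at hlaw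
  have hint : Integrable (fun e => Real.exp (-c * (y ⬝ᵥ e))) (stdGaussianVec n) := by
    have := integrable_exp_mul_gaussianReal (μ := 0) (v := (y ⬝ᵥ y).toNNReal) (-c)
    rw [← hlaw] at this
    exact this.comp_aemeasurable hgauss.aemeasurable
  have hmgf := mgf_gaussianReal hlaw (-c)
  rw [mgf, Real.coe_toNNReal _ (dotProduct_self_nonneg y)] at hmgf
  simp_rw [sub_eq_add_neg, Real.exp_add]
  rw [← ofReal_integral_eq_lintegral_ofReal (hint.mul_const _)
    (ae_of_all _ fun e => by positivity), integral_mul_const, hmgf, ← Real.exp_add]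
  ring_nf
  simp

lemma dotProduct_mulVec_le_lambdaMax {n : ℕ} {H : Matrix (Fin n) (Fin n) ℝ} (hH : H.IsHermitian)
    (v : Fin n → ℝ) : v ⬝ᵥ H *ᵥ v ≤ lambdaMax H * (v ⬝ᵥ v) := by
  obtain ⟨U, d, hU1, hU2, hUd, hev⟩ := exists_orthogonal_diagonalization hH
  have hfin : {r : ℝ | ∃ v : Fin n → ℝ, v ≠ 0 ∧ H *ᵥ v = r • v}.Finite := by
    refine (Module.End.finite_hasEigenvalue (Matrix.toLin' H)).subset ?_
    rintro r ⟨v, hv, hr⟩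
    exact Module.End.hasEigenvalue_of_hasEigenvector
      (Module.End.hasEigenvector_iff.mpr ⟨Module.End.mem_eigenspace_iff.mpr (by simpa using hr), hv⟩)
  have hd : ∀ j, d j ≤ lambdaMax H := fun j => by
    refine le_csSup hfin.bddAbove ⟨Uᵀ j, fun h0 => ?_, hev j⟩
    have := congrFun (congrFun hU1 j) j
    rw [Matrix.mul_apply] at this
    have hz : ∀ i, U i j = 0 := fun i => congrFun h0 i
    simp [hz] at this
  have hH' : H = U * diagonal d * Uᵀ := by
    rw [← hUd]
    calc H = (U * Uᵀ) * H * (U * Uᵀ) := by simp [hU2]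
      _ = _ := by simp only [Matrix.mul_assoc]
  have h1 : v ⬝ᵥ H *ᵥ v = ∑ j, d j * ((Uᵀ *ᵥ v) j * (Uᵀ *ᵥ v) j) := by
    rw [hH', ← mulVec_mulVec, ← mulVec_mulVec, dotProduct_mulVec, ← mulVec_transpose, dotProduct]
    exact Finset.sum_congr rfl fun j _ => by rw [mulVec_diagonal]; ring
  have h2 : v ⬝ᵥ v = ∑ j, (Uᵀ *ᵥ v) j * (Uᵀ *ᵥ v) j := by
    change _ = (Uᵀ *ᵥ v) ⬝ᵥ (Uᵀ *ᵥ v)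
    rw [dotProduct_mulVec, ← mulVec_transpose, transpose_transpose, mulVec_mulVec, hU2, one_mulVec]
  rw [h1, h2, Finset.mul_sum]
  exact Finset.sum_le_sum fun j _ => mul_le_mul_of_nonneg_right (hd j) (mul_self_nonneg _)

lemma dotProduct_transpose_mulVec_self {m n : ℕ} (T : Matrix (Fin m) (Fin n) ℝ) (a : Fin m → ℝ) :
    (Tᵀ *ᵥ a) ⬝ᵥ (Tᵀ *ᵥ a) = a ⬝ᵥ (T * Tᵀ) *ᵥ a := by
  rw [← mulVec_mulVec, dotProduct_mulVec a, ← mulVec_transpose]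

lemma dotProduct_transpose_mulVec_self_le {m n : ℕ} (T : Matrix (Fin m) (Fin n) ℝ)
    (hpos : 0 ≤ lambdaMax (Tᵀ * T)) (a : Fin m → ℝ) :
    (Tᵀ *ᵥ a) ⬝ᵥ (Tᵀ *ᵥ a) ≤ lambdaMax (Tᵀ * T) * (a ⬝ᵥ a) := by
  set b := Tᵀ *ᵥ a with hb
  have hab : b ⬝ᵥ b = a ⬝ᵥ T *ᵥ b := by
    rw [dotProduct_mulVec a, ← mulVec_transpose]
  have hcs : (a ⬝ᵥ T *ᵥ b) ^ 2 ≤ (a ⬝ᵥ a) * ((T *ᵥ b) ⬝ᵥ (T *ᵥ b)) := by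
    simpa only [dotProduct, sq] using
      Finset.sum_mul_sq_le_sq_mul_sq Finset.univ a (T *ᵥ b)
  have hray : (T *ᵥ b) ⬝ᵥ (T *ᵥ b) ≤ lambdaMax (Tᵀ * T) * (b ⬝ᵥ b) := by
    have := dotProduct_mulVec_le_lambdaMax (H := Tᵀ * T)
      (by simpa using isHermitian_conjTranspose_mul_self T) b
    simpa using (dotProduct_transpose_mulVec_self Tᵀ b).trans_le this
  rw [← hab] at hcs
  have ha := dotProduct_self_nonneg a
  rcases (dotProduct_self_nonneg b).eq_or_lt with h0 | h0
  · rw [← h0]; positivity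
  · have : (b ⬝ᵥ b) * (b ⬝ᵥ b) ≤ (lambdaMax (Tᵀ * T) * (a ⬝ᵥ a)) * (b ⬝ᵥ b) := by
      nlinarith [mul_le_mul_of_nonneg_left hray ha]
    exact le_of_mul_le_mul_right this h0

lemma measurable_dotProduct {Ω : Type*} [MeasurableSpace Ω] {n : ℕ} {f g : Ω → Fin n → ℝ}
    (hf : Measurable f) (hg : Measurable g) : Measurable fun ω => f ω ⬝ᵥ g ω := by
  unfold dotProduct
  fun_prop

section AdaptedRegression

variable {T nu n : ℕ} {y : Fin T → (Fin T → Fin nu → ℝ) × (Fin T → Fin n → ℝ) → Fin n → ℝ}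

lemma lintegral_exp_adapted_le_one (hmeas : ∀ t, Measurable (y t))
    (hadapted : ∀ s t, s ≤ t → ∀ h g e, y s (h, Function.update g t e) = y s (h, g)) (c : ℝ) :
    ∫⁻ ω, ENNReal.ofReal (Real.exp (∑ t, (-c * (y t ω ⬝ᵥ ω.2 t) - c ^ 2 / 2 * (y t ω ⬝ᵥ y t ω))))
      ∂((stdGaussianSeq T nu).prod (stdGaussianSeq T n)) ≤ 1 := by
  have hF : ∀ t, Measurable fun ω : (Fin T → Fin nu → ℝ) × (Fin T → Fin n → ℝ) =>
      ENNReal.ofReal (Real.exp (-c * (y t ω ⬝ᵥ ω.2 t) - c ^ 2 / 2 * (y t ω ⬝ᵥ y t ω))) := fun t => by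
    have h1 := measurable_dotProduct (hmeas t) (g := fun ω => ω.2 t) (by fun_prop)
    have h2 := measurable_dotProduct (hmeas t) (hmeas t)
    fun_prop
  simp_rw [Real.exp_sum, ENNReal.ofReal_prod_of_nonneg fun _ _ => (Real.exp_pos _).le]
  rw [lintegral_prod _ (Finset.measurable_prod _ fun t _ => hF t).aemeasurable]
  refine (lintegral_mono (g := fun _ => 1) fun h => ?_).trans (by simp)
  refine lintegral_prod_adapted_le_one (stdGaussianVec n)
    (fun t g => ENNReal.ofReal
      (Real.exp (-c * (y t (h, g) ⬝ᵥ g t) - c ^ 2 / 2 * (y t (h, g) ⬝ᵥ y t (h, g)))))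
    (fun t => (hF t).comp measurable_prodMk_left) (fun s t hst g e => ?_) (fun t g => ?_)
  · simp only [hadapted s t hst.le, Function.update_of_ne hst.ne]
  · simp only [hadapted t t le_rfl, Function.update_self]
    exact (lintegral_exp_dotProduct_stdGaussianVec (y t (h, g)) c).le

theorem integral_exp_neg_adapted_le (hT : 1 ≤ T)
    (hgauss : ∀ t, HasGaussianLaw (y t) ((stdGaussianSeq T nu).prod (stdGaussianSeq T n)))
    (hmeas : ∀ t, Measurable (y t))
    (hadapted : ∀ s t, s ≤ t → ∀ h g e, y s (h, Function.update g t e) = y s (h, g))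
    {c η : ℝ} (hvar : ∀ t (a : Fin n → ℝ),
      Var[fun ω => a ⬝ᵥ y t ω; (stdGaussianSeq T nu).prod (stdGaussianSeq T n)] ≤ c * (a ⬝ᵥ a))
    (hη : 0 ≤ η) (hηT : η * T ≤ 1 / 4) (hηc : η * T * c ≤ 1 / 8) :
    ∫ ω, Real.exp (-η * ∑ t, (y t ω ⬝ᵥ y t ω + 2 * (y t ω ⬝ᵥ ω.2 t)))
        ∂((stdGaussianSeq T nu).prod (stdGaussianSeq T n))
      ≤ Real.exp (-(η / 4) * ∑ t, ∫ ω, y t ω ⬝ᵥ y t ω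
          ∂((stdGaussianSeq T nu).prod (stdGaussianSeq T n))) := by
  set P := (stdGaussianSeq T nu).prod (stdGaussianSeq T n)
  have hT' : (1 : ℝ) ≤ T := by exact_mod_cast hT
  have hT0 : (0 : ℝ) < T := by linarith
  have hη4 : η ≤ 1 / 4 := by nlinarith
  let M : (Fin T → Fin nu → ℝ) × (Fin T → Fin n → ℝ) → ℝ := fun ω =>
    ∑ t, (-(8 / 3 * η) * (y t ω ⬝ᵥ ω.2 t) - (8 / 3 * η) ^ 2 / 2 * (y t ω ⬝ᵥ y t ω))
  let κ : Fin T → ℝ := fun t => T * η * ∫ ω, y t ω ⬝ᵥ y t ω ∂P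
  let Q : Fin T → (Fin T → Fin nu → ℝ) × (Fin T → Fin n → ℝ) → ℝ := fun t ω =>
    -(4 / 3 * T * η) * (y t ω ⬝ᵥ y t ω)
  have hmS : ∀ t, Measurable fun ω => y t ω ⬝ᵥ y t ω := fun t =>
    measurable_dotProduct (hmeas t) (hmeas t)
  have hmM : Measurable M := Finset.measurable_sum _ fun t _ => by
    have h1 := measurable_dotProduct (hmeas t) (g := fun ω => ω.2 t) (by fun_prop)
    have h2 := hmS t
    fun_prop
  have hle : ∫⁻ ω, ENNReal.ofReal (Real.exp (M ω)) ∂P ≤ 1 :=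
    lintegral_exp_adapted_le_one hmeas hadapted _
  have hMint : Integrable (fun ω => Real.exp (M ω)) P := by
    refine ⟨hmM.exp.aestronglyMeasurable, ?_⟩
    rw [hasFiniteIntegral_iff_ofReal (ae_of_all _ fun ω => (Real.exp_pos _).le)]
    exact hle.trans_lt ENNReal.one_lt_top
  have hMle : ∫ ω, Real.exp (M ω) ∂P ≤ 1 := by
    rw [integral_eq_lintegral_of_nonneg_ae (ae_of_all _ fun ω => (Real.exp_pos _).le)
      hmM.exp.aestronglyMeasurable]
    exact ENNReal.toReal_le_of_le_ofReal zero_le_one (by simpa using hle)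
  have hQint : ∀ t, Integrable (fun ω => Real.exp (Q t ω + κ t)) P := fun t => by
    refine Integrable.of_bound (C := Real.exp (κ t)) ?_ (ae_of_all _ fun ω => ?_)
    · have := hmS t
      exact Measurable.aestronglyMeasurable (by fun_prop)
    · rw [Real.norm_eq_abs, abs_of_pos (Real.exp_pos _), Real.exp_le_exp]
      have : 0 ≤ 4 / 3 * T * η * (y t ω ⬝ᵥ y t ω) :=
        mul_nonneg (by positivity) (dotProduct_self_nonneg _)
      simp only [Q]
      linarith
  have hQle : ∀ t, ∫ ω, Real.exp (Q t ω + κ t) ∂P ≤ 1 := fun t => by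
    have h := integral_exp_neg_mul_dotProduct_self_le (hgauss t) (lam := 4 / 3 * T * η)
      (by positivity) (by linarith) (hvar t)
    simp_rw [Real.exp_add]
    rw [integral_mul_const]
    calc _ ≤ Real.exp (-(3 / 4) * (4 / 3 * T * η) * ∫ ω, y t ω ⬝ᵥ y t ω ∂P) * Real.exp (κ t) := by
          gcongr
      _ = 1 := by
          rw [← Real.exp_add, Real.exp_eq_one_iff]
          simp only [κ]
          ring
  have hpt : ∀ ω, Real.exp (-η * ∑ t, (y t ω ⬝ᵥ y t ω + 2 * (y t ω ⬝ᵥ ω.2 t)))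
      ≤ Real.exp (-(η / 4) * ∑ t, ∫ ω, y t ω ⬝ᵥ y t ω ∂P) *
        (3 / 4 * Real.exp (M ω) + 1 / 4 * ∑ t, (T : ℝ)⁻¹ * Real.exp (Q t ω + κ t)) := fun ω => by
    have hjen : Real.exp (∑ t, (T : ℝ)⁻¹ * (Q t ω + κ t))
        ≤ ∑ t, (T : ℝ)⁻¹ * Real.exp (Q t ω + κ t) := by
      simpa using convexOn_exp.map_sum_le (t := Finset.univ) (w := fun _ : Fin T => (T : ℝ)⁻¹)
        (p := fun t => Q t ω + κ t) (fun _ _ => by positivity) (by simp [hT0.ne'])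
        (fun _ _ => Set.mem_univ _)
    have hconv : Real.exp (3 / 4 * M ω + 1 / 4 * ∑ t, (T : ℝ)⁻¹ * (Q t ω + κ t))
        ≤ 3 / 4 * Real.exp (M ω) + 1 / 4 * Real.exp (∑ t, (T : ℝ)⁻¹ * (Q t ω + κ t)) :=
      convexOn_exp.2 (Set.mem_univ _) (Set.mem_univ _) (by norm_num) (by norm_num) (by norm_num)
    refine le_trans ?_ (mul_le_mul_of_nonneg_left
      (hconv.trans (by gcongr)) (Real.exp_pos _).le)
    rw [← Real.exp_add, Real.exp_le_exp]
    simp only [M, Finset.mul_sum]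
    rw [← Finset.sum_add_distrib, ← Finset.sum_add_distrib]
    refine Finset.sum_le_sum fun t _ => ?_
    have hS : 0 ≤ y t ω ⬝ᵥ y t ω := dotProduct_self_nonneg _
    have e1 : (T : ℝ)⁻¹ * (Q t ω + κ t)
        = -(4 / 3 * η) * (y t ω ⬝ᵥ y t ω) + η * ∫ ω, y t ω ⬝ᵥ y t ω ∂P := by
      simp only [Q, κ]
      field_simp
    rw [e1]
    nlinarith [mul_nonneg (mul_nonneg hη (sub_nonneg.mpr hη4)) hS]
  have hRint : Integrable (fun ω =>
      3 / 4 * Real.exp (M ω) + 1 / 4 * ∑ t, (T : ℝ)⁻¹ * Real.exp (Q t ω + κ t)) P :=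
    (hMint.const_mul _).add
      ((integrable_finsetSum _ fun t _ => (hQint t).const_mul _).const_mul _)
  refine (integral_mono_of_nonneg (ae_of_all _ fun ω => (Real.exp_pos _).le)
    (hRint.const_mul _) (ae_of_all _ hpt)).trans ?_
  rw [integral_const_mul, integral_add (hMint.const_mul _)
      ((integrable_finsetSum _ fun t _ => (hQint t).const_mul _).const_mul _),
    integral_const_mul, integral_const_mul,
    integral_finsetSum _ fun t _ => (hQint t).const_mul _]
  simp_rw [integral_const_mul]
  refine mul_le_of_le_one_right (Real.exp_pos _).le ?_
  have hsum : ∑ t, (T : ℝ)⁻¹ * ∫ ω, Real.exp (Q t ω + κ t) ∂P ≤ 1 :=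
    calc _ ≤ ∑ _t : Fin T, (T : ℝ)⁻¹ * 1 := by
          gcongr with t
          exact hQle t
      _ = 1 := by simp [hT0.ne']
  linarith

end AdaptedRegression

section Trajectory

variable {T nx nu : ℕ}

lemma dotProduct_affine {n : ℕ} (m a : Fin n → ℝ) (G : Fin T → Matrix (Fin n) (Fin nu) ℝ)
    (K : Fin T → Matrix (Fin n) (Fin nx) ℝ) (h : Fin T → Fin nu → ℝ) (g : Fin T → Fin nx → ℝ) :
    a ⬝ᵥ (m + (∑ s, G s *ᵥ h s + ∑ s, K s *ᵥ g s))
      = a ⬝ᵥ m + (∑ s, ((G s)ᵀ *ᵥ a) ⬝ᵥ h s + ∑ s, ((K s)ᵀ *ᵥ a) ⬝ᵥ g s) := by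
  simp only [dotProduct_add, dotProduct_sum, dotProduct_mulVec, mulVec_transpose]

lemma hasGaussianLaw_affine {n : ℕ} (m : Fin n → ℝ) (G : Fin T → Matrix (Fin n) (Fin nu) ℝ)
    (K : Fin T → Matrix (Fin n) (Fin nx) ℝ) :
    HasGaussianLaw (fun ω => m + (∑ s, G s *ᵥ ω.1 s + ∑ s, K s *ᵥ ω.2 s))
      ((stdGaussianSeq T nu).prod (stdGaussianSeq T nx)) := by
  refine hasGaussianLaw_stdGaussianSeq_prod m
    (fun i s => (G s)ᵀ *ᵥ Pi.single i 1) (fun i s => (K s)ᵀ *ᵥ Pi.single i 1) fun i ω => ?_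
  simpa using dotProduct_affine m (Pi.single i 1) G K ω.1 ω.2

lemma variance_dotProduct_affine {n : ℕ} (m a : Fin n → ℝ)
    (G : Fin T → Matrix (Fin n) (Fin nu) ℝ) (K : Fin T → Matrix (Fin n) (Fin nx) ℝ) :
    Var[fun ω => a ⬝ᵥ (m + (∑ s, G s *ᵥ ω.1 s + ∑ s, K s *ᵥ ω.2 s));
        (stdGaussianSeq T nu).prod (stdGaussianSeq T nx)]
      = ∑ s, a ⬝ᵥ (G s * (G s)ᵀ) *ᵥ a + ∑ s, a ⬝ᵥ (K s * (K s)ᵀ) *ᵥ a := by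
  simp_rw [dotProduct_affine, variance_stdGaussianSeq_prod, dotProduct_transpose_mulVec_self]

lemma exists_trajectory_eq {A : Matrix (Fin nx) (Fin nx) ℝ} {B : Matrix (Fin nx) (Fin nu) ℝ}
    {V : Matrix (Fin nu) (Fin nu) ℝ} {W : Matrix (Fin nx) (Fin nx) ℝ} {ud : Fin T → Fin nu → ℝ}
    {x₀ : Fin nx → ℝ} {x : ℕ → (Fin T → Fin nu → ℝ) × (Fin T → Fin nx → ℝ) → Fin nx → ℝ}
    (hx0 : ∀ ω, x 0 ω = x₀)
    (hxrec : ∀ (t : Fin T) ω,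
      x (t + 1) ω = A *ᵥ x t ω + B *ᵥ (ud t + V *ᵥ ω.1 t) + W *ᵥ ω.2 t) (t : ℕ) (ht : t ≤ T) :
    ∃ m, ∀ ω, x t ω = m + ∑ s : Fin T,
      if s < t then A ^ (t - 1 - s) *ᵥ (B *ᵥ V *ᵥ ω.1 s + W *ᵥ ω.2 s) else 0 := by
  induction t with
  | zero => exact ⟨x₀, fun ω => by simp [hx0]⟩
  | succ t ih =>
    obtain ⟨m, hm⟩ := ih (by omega)
    refine ⟨A *ᵥ m + B *ᵥ ud ⟨t, ht⟩, fun ω => ?_⟩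
    have hsplit : ∀ s : Fin T,
        (if (s : ℕ) < t + 1 then A ^ (t + 1 - 1 - s) *ᵥ (B *ᵥ V *ᵥ ω.1 s + W *ᵥ ω.2 s) else 0)
          = A *ᵥ (if (s : ℕ) < t then A ^ (t - 1 - s) *ᵥ (B *ᵥ V *ᵥ ω.1 s + W *ᵥ ω.2 s) else 0)
            + if s = ⟨t, ht⟩ then B *ᵥ V *ᵥ ω.1 s + W *ᵥ ω.2 s else 0 := fun s => by
      rcases lt_trichotomy (s : ℕ) t with hs | hs | hs
      · have hne : s ≠ ⟨t, ht⟩ := fun h => by simp [h] at hs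
        rw [if_pos (by omega), if_pos hs, if_neg hne,
          mulVec_mulVec _ A, ← pow_succ', add_zero]
        congr 2
        omega
      · obtain rfl : s = ⟨t, ht⟩ := Fin.ext hs
        simp
      · have hne : s ≠ ⟨t, ht⟩ := fun h => by simp [h] at hs
        simp [hne, show ¬ (s : ℕ) < t + 1 by omega, show ¬ (s : ℕ) < t by omega]
    rw [Finset.sum_congr rfl fun s _ => hsplit s, Finset.sum_add_distrib, Finset.sum_ite_eq',
      if_pos (Finset.mem_univ _), ← mulVec_sum, hxrec ⟨t, ht⟩ ω, hm ω]
    simp only [mulVec_add]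
    abel

/-- Response of `C x(t) + D u(t)` to the input noise at time `s`. -/
def inputResponse (A : Matrix (Fin nx) (Fin nx) ℝ) (B : Matrix (Fin nx) (Fin nu) ℝ)
    (C : Matrix (Fin nx) (Fin nx) ℝ) (D : Matrix (Fin nx) (Fin nu) ℝ)
    (V : Matrix (Fin nu) (Fin nu) ℝ) (t s : ℕ) : Matrix (Fin nx) (Fin nu) ℝ :=
  (if s < t then C * A ^ (t - 1 - s) * B * V else 0) + if s = t then D * V else 0

/-- Response of `C x(t) + D u(t)` to the process noise at time `s`. -/
def noiseResponse (A C W : Matrix (Fin nx) (Fin nx) ℝ) (t s : ℕ) : Matrix (Fin nx) (Fin nx) ℝ :=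
  if s < t then C * A ^ (t - 1 - s) * W else 0

lemma exists_output_eq {A : Matrix (Fin nx) (Fin nx) ℝ} {B : Matrix (Fin nx) (Fin nu) ℝ}
    {V : Matrix (Fin nu) (Fin nu) ℝ} {W : Matrix (Fin nx) (Fin nx) ℝ} {ud : Fin T → Fin nu → ℝ}
    {x₀ : Fin nx → ℝ} {x : ℕ → (Fin T → Fin nu → ℝ) × (Fin T → Fin nx → ℝ) → Fin nx → ℝ}
    (hx0 : ∀ ω, x 0 ω = x₀)
    (hxrec : ∀ (t : Fin T) ω,
      x (t + 1) ω = A *ᵥ x t ω + B *ᵥ (ud t + V *ᵥ ω.1 t) + W *ᵥ ω.2 t)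
    (C : Matrix (Fin nx) (Fin nx) ℝ) (D : Matrix (Fin nx) (Fin nu) ℝ) (t : Fin T) :
    ∃ m, ∀ ω, C *ᵥ x t ω + D *ᵥ (ud t + V *ᵥ ω.1 t)
      = m + (∑ s : Fin T, inputResponse A B C D V t s *ᵥ ω.1 s
        + ∑ s : Fin T, noiseResponse A C W t s *ᵥ ω.2 s) := by
  obtain ⟨m, hm⟩ := exists_trajectory_eq hx0 hxrec t t.isLt.le
  refine ⟨C *ᵥ m + D *ᵥ ud t, fun ω => ?_⟩
  have hs : ∀ s : Fin T, inputResponse A B C D V t s *ᵥ ω.1 s + noiseResponse A C W t s *ᵥ ω.2 s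
      = C *ᵥ (if (s : ℕ) < t then A ^ ((t : ℕ) - 1 - s) *ᵥ (B *ᵥ V *ᵥ ω.1 s + W *ᵥ ω.2 s) else 0)
        + if s = t then D *ᵥ V *ᵥ ω.1 s else 0 := fun s => by
    unfold inputResponse noiseResponse
    rcases eq_or_ne s t with rfl | hne
    · simp
    · have hne' : (s : ℕ) ≠ t := fun h => hne (Fin.ext h)
      split_ifs <;> simp [mulVec_add, mulVec_mulVec, Matrix.mul_assoc]
  rw [← Finset.sum_add_distrib, Finset.sum_congr rfl fun s _ => hs s, Finset.sum_add_distrib,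
    Finset.sum_ite_eq', if_pos (Finset.mem_univ _), ← mulVec_sum, hm ω]
  simp only [mulVec_add]
  abel

lemma sum_fin_ite_lt_reflect_le {r : ℕ → ℝ} (hr : ∀ k, 0 ≤ r k) {t : ℕ} (ht : t ≤ T) :
    ∑ s : Fin T, (if (s : ℕ) < t then r (t - 1 - s) else 0) ≤ ∑ s : Fin T, r (T - 1 - s) := by
  rw [Fin.sum_univ_eq_sum_range (fun s => if s < t then r (t - 1 - s) else 0),
    Fin.sum_univ_eq_sum_range (fun s => r (T - 1 - s)), Finset.sum_range_reflect,
    ← Finset.sum_filter,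
    show (Finset.range T).filter (· < t) = Finset.range t by ext; simp; omega,
    Finset.sum_range_reflect]
  exact Finset.sum_le_sum_of_subset_of_nonneg (Finset.range_subset_range.mpr ht) fun k _ _ => hr k

lemma sum_response_le {A : Matrix (Fin nx) (Fin nx) ℝ} {B : Matrix (Fin nx) (Fin nu) ℝ}
    {V : Matrix (Fin nu) (Fin nu) ℝ} {W : Matrix (Fin nx) (Fin nx) ℝ}
    (C : Matrix (Fin nx) (Fin nx) ℝ) (D : Matrix (Fin nx) (Fin nu) ℝ) (t : Fin T)
    (b : Fin nx → ℝ) :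
    ∑ s : Fin T, b ⬝ᵥ (inputResponse A B C D V t s * (inputResponse A B C D V t s)ᵀ) *ᵥ b
        + ∑ s : Fin T, b ⬝ᵥ (noiseResponse A C W t s * (noiseResponse A C W t s)ᵀ) *ᵥ b
      ≤ b ⬝ᵥ (C * (∑ s : Fin T, A ^ (T - 1 - s) * (B * (V * Vᵀ) * Bᵀ + W * Wᵀ) *
            (A ^ (T - 1 - s))ᵀ) * Cᵀ + D * (V * Vᵀ) * Dᵀ) *ᵥ b := by
  let R : ℕ → Matrix (Fin nx) (Fin nx) ℝ := fun k =>
    (C * A ^ k * B * V) * (C * A ^ k * B * V)ᵀ + (C * A ^ k * W) * (C * A ^ k * W)ᵀ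
  have hR : ∀ k, 0 ≤ b ⬝ᵥ R k *ᵥ b := fun k => by
    simp only [R, add_mulVec, dotProduct_add, ← dotProduct_transpose_mulVec_self]
    exact add_nonneg (dotProduct_self_nonneg _) (dotProduct_self_nonneg _)
  have hrhs : C * (∑ s : Fin T, A ^ (T - 1 - s) * (B * (V * Vᵀ) * Bᵀ + W * Wᵀ) *
      (A ^ (T - 1 - s))ᵀ) * Cᵀ = ∑ s : Fin T, R (T - 1 - s) := by
    rw [Finset.mul_sum, Finset.sum_mul]
    refine Finset.sum_congr rfl fun s _ => ?_
    simp only [R, transpose_mul, Matrix.mul_add, Matrix.add_mul, Matrix.mul_assoc]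
  have hlhs : ∀ s : Fin T,
      b ⬝ᵥ (inputResponse A B C D V t s * (inputResponse A B C D V t s)ᵀ) *ᵥ b
        + b ⬝ᵥ (noiseResponse A C W t s * (noiseResponse A C W t s)ᵀ) *ᵥ b
      = (if (s : ℕ) < t then b ⬝ᵥ R (t - 1 - s) *ᵥ b else 0)
        + if s = t then b ⬝ᵥ (D * (V * Vᵀ) * Dᵀ) *ᵥ b else 0 := fun s => by
    unfold inputResponse noiseResponse
    rcases eq_or_ne s t with rfl | hne
    · simp [Matrix.mul_assoc]
    · have hne' : (s : ℕ) ≠ t := fun h => hne (Fin.ext h)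
      split_ifs <;> simp [R, add_mulVec]
  rw [← Finset.sum_add_distrib, Finset.sum_congr rfl fun s _ => hlhs s, Finset.sum_add_distrib,
    Finset.sum_ite_eq', if_pos (Finset.mem_univ _), hrhs, add_mulVec, dotProduct_add, sum_mulVec,
    dotProduct_sum]
  refine add_le_add_left ?_ _
  exact sum_fin_ite_lt_reflect_le hR t.isLt.le

end Trajectory

/-- Per-block exponential prediction-error inequality (core of Proposition E.1 of the paper):
for the input `u(t) = u_d(t) + Σ_u^{1/2} h(t)` and suitable `η`,
`E[exp(−η(ε_{θ_i} − ε_{θ_*}))] ≤ exp(−(η/4)·Σ_t E[‖ΔA_i x(t) + ΔB_i u(t)‖²_{Σ_w⁻¹}])`. -/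
theorem per_block_exponential_inequality
    (nx nu τ : ℕ) (hnx : 1 ≤ nx) (hnu : 1 ≤ nu) (hτ : 1 ≤ τ)
    (Astar : Matrix (Fin nx) (Fin nx) ℝ) (Bstar : Matrix (Fin nx) (Fin nu) ℝ)
    (Sigw sqrtSigw : Matrix (Fin nx) (Fin nx) ℝ)
    (hSigw : Sigw.PosDef) (hsqrtW : sqrtSigw.PosSemidef) (hsqrtW2 : sqrtSigw * sqrtSigw = Sigw)
    (Ai : Matrix (Fin nx) (Fin nx) ℝ) (Bi : Matrix (Fin nx) (Fin nu) ℝ)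
    (hΔ : ¬(Astar - Ai = 0 ∧ Bstar - Bi = 0))
    (Sigu sqrtSigu : Matrix (Fin nu) (Fin nu) ℝ)
    (hSigu : Sigu.PosDef) (hsqrtU : sqrtSigu.PosSemidef) (hsqrtU2 : sqrtSigu * sqrtSigu = Sigu)
    (ud : Fin τ → Fin nu → ℝ) (x₀ : Fin nx → ℝ)
    (x : ℕ → ((Fin τ → Fin nu → ℝ) × (Fin τ → Fin nx → ℝ)) → (Fin nx → ℝ))
    (hx0 : ∀ ω, x 0 ω = x₀)
    (hxrec : ∀ (t : Fin τ) ω,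
      x ((t : ℕ) + 1) ω =
        Astar.mulVec (x (t : ℕ) ω)
          + Bstar.mulVec (ud t + sqrtSigu.mulVec (ω.1 t))
          + sqrtSigw.mulVec (ω.2 t))
    (sqrtSigΔ : Matrix (Fin nx) (Fin nx) ℝ) (hsqrtΔ : sqrtSigΔ.PosSemidef)
    (hsqrtΔ2 : sqrtSigΔ * sqrtSigΔ =
      (Astar - Ai) *
          (∑ s : Fin τ, Astar ^ (τ - 1 - (s : ℕ)) * (Bstar * Sigu * Bstarᵀ + Sigw) *
            (Astar ^ (τ - 1 - (s : ℕ)))ᵀ) * (Astar - Ai)ᵀ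
        + (Bstar - Bi) * Sigu * (Bstar - Bi)ᵀ)
    (hlamPos : 0 < lambdaMax (sqrtSigΔ * Sigw⁻¹ * sqrtSigΔ))
    (η : ℝ) (heta : 0 < η) (hetaTau : η * τ ≤ 1 / 4)
    (hetaLam : η * τ * lambdaMax (sqrtSigΔ * Sigw⁻¹ * sqrtSigΔ) ≤ 1 / 512) :
    (∫ ω, Real.exp (-η *
        ((∑ t : Fin τ, wnormSq Sigw⁻¹
            (x ((t : ℕ) + 1) ω - Ai.mulVec (x (t : ℕ) ω)
              - Bi.mulVec (ud t + sqrtSigu.mulVec (ω.1 t))))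
          - ∑ t : Fin τ, wnormSq Sigw⁻¹
              (x ((t : ℕ) + 1) ω - Astar.mulVec (x (t : ℕ) ω)
                - Bstar.mulVec (ud t + sqrtSigu.mulVec (ω.1 t)))))
        ∂((stdGaussianSeq τ nu).prod (stdGaussianSeq τ nx)))
      ≤ Real.exp (-(η / 4) *
          ∑ t : Fin τ,
            ∫ ω, wnormSq Sigw⁻¹
                ((Astar - Ai).mulVec (x (t : ℕ) ω)
                  + (Bstar - Bi).mulVec (ud t + sqrtSigu.mulVec (ω.1 t)))
              ∂((stdGaussianSeq τ nu).prod (stdGaussianSeq τ nx))) := by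
  have hV : sqrtSiguᵀ = sqrtSigu := hsqrtU.isHermitian
  have hW : sqrtSigwᵀ = sqrtSigw := hsqrtW.isHermitian
  have hD : sqrtSigΔᵀ = sqrtSigΔ := hsqrtΔ.isHermitian
  set N := sqrtSigw⁻¹ with hN
  have hNt : Nᵀ = N := by rw [hN, transpose_nonsing_inv, hW]
  have hNN : N * N = Sigw⁻¹ := by rw [← hsqrtW2, Matrix.mul_inv_rev]
  have hNW : N * sqrtSigw = 1 := by
    refine nonsing_inv_mul _ (isUnit_iff_ne_zero.mpr fun h => ?_)
    have := hSigw.det_pos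
    rw [← hsqrtW2, det_mul, h] at this
    simp at this
  have hnorm : ∀ v, wnormSq Sigw⁻¹ v = (N *ᵥ v) ⬝ᵥ (N *ᵥ v) := fun v => by
    rw [wnormSq, ← hNN, ← congrArg (N * ·) hNt, ← dotProduct_transpose_mulVec_self, hNt]
  choose m hm using exists_output_eq hx0 hxrec (Astar - Ai) (Bstar - Bi)
  let v : Fin τ → (Fin τ → Fin nu → ℝ) × (Fin τ → Fin nx → ℝ) → Fin nx → ℝ := fun t ω =>
    (Astar - Ai) *ᵥ x t ω + (Bstar - Bi) *ᵥ (ud t + sqrtSigu *ᵥ ω.1 t)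
  have hv : ∀ t, v t = fun ω => m t + (∑ s : Fin τ,
        inputResponse Astar Bstar (Astar - Ai) (Bstar - Bi) sqrtSigu t s *ᵥ ω.1 s
      + ∑ s : Fin τ, noiseResponse Astar (Astar - Ai) sqrtSigw t s *ᵥ ω.2 s) :=
    fun t => funext (hm t)
  have hgram : (N * sqrtSigΔ)ᵀ * (N * sqrtSigΔ) = sqrtSigΔ * Sigw⁻¹ * sqrtSigΔ := by
    rw [transpose_mul, hNt, hD, ← hNN]
    simp only [Matrix.mul_assoc]
  have hvar : ∀ t (a : Fin nx → ℝ), Var[fun ω => a ⬝ᵥ N *ᵥ v t ω;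
      (stdGaussianSeq τ nu).prod (stdGaussianSeq τ nx)]
        ≤ lambdaMax (sqrtSigΔ * Sigw⁻¹ * sqrtSigΔ) * (a ⬝ᵥ a) := fun t a => by
    have hle := dotProduct_transpose_mulVec_self_le (N * sqrtSigΔ)
      (by rw [hgram]; exact hlamPos.le) a
    rw [hgram, transpose_mul, hD, hNt, ← mulVec_mulVec] at hle
    simp_rw [dotProduct_mulVec a, ← mulVec_transpose, hNt, hv t]
    rw [variance_dotProduct_affine]
    refine (sum_response_le _ _ t _).trans (le_trans (le_of_eq ?_) hle)
    rw [hV, hW, hsqrtU2, hsqrtW2, ← hsqrtΔ2, ← congrArg (sqrtSigΔ * ·) hD,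
      ← dotProduct_transpose_mulVec_self, hD]
  have key := integral_exp_neg_adapted_le (y := fun t ω => N *ᵥ v t ω) hτ
    (fun t => by
      rw [hv t]
      exact (hasGaussianLaw_affine _ _ _).map_fun (LinearMap.toContinuousLinearMap N.mulVecLin))
    (fun t => by
      simp only [hv t]
      exact Continuous.measurable (by fun_prop))
    (fun s t hst h g e => by
      simp only [hv s]
      congr 3
      refine Finset.sum_congr rfl fun j _ => ?_
      unfold noiseResponse
      split_ifs with hj
      · rw [Function.update_of_ne (fun h => by omega)]
      · simp)
    hvar heta.le hetaTau (by linarith)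
  have hres : ∀ (t : Fin τ) ω,
      wnormSq Sigw⁻¹ (x (t + 1) ω - Ai *ᵥ x t ω - Bi *ᵥ (ud t + sqrtSigu *ᵥ ω.1 t))
        - wnormSq Sigw⁻¹ (x (t + 1) ω - Astar *ᵥ x t ω - Bstar *ᵥ (ud t + sqrtSigu *ᵥ ω.1 t))
      = (N *ᵥ v t ω) ⬝ᵥ (N *ᵥ v t ω) + 2 * ((N *ᵥ v t ω) ⬝ᵥ ω.2 t) := fun t ω => by
    have h1 : x (t + 1) ω - Ai *ᵥ x t ω - Bi *ᵥ (ud t + sqrtSigu *ᵥ ω.1 t)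
        = v t ω + sqrtSigw *ᵥ ω.2 t := by
      simp only [v, hxrec, sub_mulVec]
      abel
    have h2 : x (t + 1) ω - Astar *ᵥ x t ω - Bstar *ᵥ (ud t + sqrtSigu *ᵥ ω.1 t)
        = sqrtSigw *ᵥ ω.2 t := by
      rw [hxrec]
      abel
    rw [h1, h2, hnorm, hnorm, mulVec_add, mulVec_mulVec, hNW, one_mulVec]
    simp only [add_dotProduct, dotProduct_add]
    rw [dotProduct_comm (ω.2 t)]
    ring
  simp_rw [← Finset.sum_sub_distrib, hres, hnorm]
  exact key
end
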